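/- Suppose X = (X_t)_{t∈[0,T]} has almost surely continuous sample paths in ℝ^d and satisfies conditions (A1) and (A2) for some α ∈ (0, 1/d), θ ≥ 0 and ι ∈ [0,1]. Then there exists a version L̃ of the local time and, for every β ∈ (0, 1 − dα), a finite random variable η such that, almost surely, for every fixed x ∈ ℝ^d and all s, t ∈ [0,T]: |L̃(x,t) − L̃(x,s)| ≤ η |t − s|^{β}. -/

import Mathlib

open MeasureTheory Filter Topology Set RealInnerProductSpace

noncomputable section

abbrev Ed (d : ℕ) := EuclideanSpace ℝ (Fin d)

/-- Condition (A1) of the paper: for every m, every collection of frequencies with nonzero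
coordinates, every partition `0 = t₀ < t₁ < … < t_m < T` and every choice of exponents
`k_{j,l} ∈ {0,4}`, the characteristic function of the linear combination of increments
satisfies the stated bound. -/
def CondA1 {Ω : Type*} [MeasurableSpace Ω] {d : ℕ} (P : Measure Ω)
    (X : ℝ → Ω → Ed d) (T α θ : ℝ) : Prop :=
  ∃ C : ℝ, 0 < C ∧
    ∀ m : ℕ, 0 < m → ∀ ξ : Fin m → Ed d, (∀ j l, ξ j l ≠ 0) →
      ∀ t : Fin (m + 1) → ℝ, StrictMono t → t 0 = 0 → t (Fin.last m) < T →
        ∀ k : Fin m → Fin d → ℕ, (∀ j l, k j l = 0 ∨ k j l = 4) →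
          ‖∫ ω, Complex.exp (Complex.I * Complex.ofReal
              (∑ j, ⟪ξ j, X (t j.succ) ω - X (t j.castSucc) ω⟫)) ∂P‖ ≤
            C ^ m * (m : ℝ) ^ (α * θ * (m : ℝ)) *
              ∏ j, ∏ l, (|ξ j l| ^ (k j l))⁻¹ *
                ((t j.succ - t j.castSucc) ^ (α * (k j l : ℝ)))⁻¹

/-- Condition (A2) of the paper: moment bounds for the increments. -/
def CondA2 {Ω : Type*} [MeasurableSpace Ω] {d : ℕ} (P : Measure Ω)
    (X : ℝ → Ω → Ed d) (T α ι : ℝ) : Prop :=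
  ∃ C : ℝ, 0 < C ∧
    ∀ p : ℝ, 1 ≤ p → ∀ s t : ℝ, 0 ≤ s → s ≤ t → t ≤ T →
      ∫ ω, ‖X t ω - X s ω‖ ^ p ∂P ≤ C ^ p * p ^ (p * ι) * |t - s| ^ (p * α)

/-- `L` is an occupation density (local time) of the path `u ↦ X u ω` on `[0,T]`:
for every Borel `B ⊆ [0,T]` and Borel `A ⊆ ℝ^d`, the occupation measure
`τ(A,B) = λ(B ∩ X⁻¹(A))` equals `∫_A L(x,B) dx`. -/
def IsOccDensity {Ω : Type*} [MeasurableSpace Ω] {d : ℕ}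
    (X : ℝ → Ω → Ed d) (T : ℝ) (L : Ed d → Set ℝ → Ω → ℝ) (ω : Ω) : Prop :=
  ∀ B : Set ℝ, MeasurableSet B → B ⊆ Icc 0 T →
    ∀ A : Set (Ed d), MeasurableSet A →
      volume (B ∩ {u | X u ω ∈ A}) = ENNReal.ofReal (∫ x in A, L x B ω)

open scoped ENNReal NNReal

section PiMeasure

variable {E : Type*} [MeasurableSpace E] (μ : Measure E) [SigmaFinite μ]

/-- Tonelli's theorem for a product of functions of one variable each. -/
lemma lintegral_fin_prod_eq_prod {n : ℕ} (f : Fin n → E → ℝ≥0∞) (hf : ∀ i, Measurable (f i)) :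
    ∫⁻ x, ∏ i, f i (x i) ∂Measure.pi (fun _ : Fin n => μ) = ∏ i, ∫⁻ y, f i y ∂μ := by
  induction n with
  | zero => simp
  | succ n ih =>
    rw [← ((measurePreserving_piFinSuccAbove (fun _ : Fin (n + 1) => μ) 0).symm).lintegral_comp_emb
      (MeasurableEquiv.measurableEmbedding _)]
    simp_rw [MeasurableEquiv.piFinSuccAbove_symm_apply, Fin.insertNthEquiv,
      Fin.prod_univ_succ, Fin.insertNth_zero]
    simp only [Equiv.coe_fn_mk, Fin.cons_zero, Fin.cons_succ]
    rw [← ih (fun i => f i.succ) (fun i => hf _)]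
    exact lintegral_prod_mul (hf 0).aemeasurable
      (Finset.measurable_prod _ fun i _ => (hf _).comp (measurable_pi_apply i)).aemeasurable

variable [AddCommGroup E] [MeasurableAdd₂ E] [μ.IsAddLeftInvariant]

/-- Taking partial sums from the left is a shear, hence preserves a translation invariant
product measure. -/
lemma measurePreserving_sum_Iic (n : ℕ) :
    MeasurePreserving (fun (u : Fin n → E) j => ∑ i ∈ Finset.Iic j, u i)
      (Measure.pi fun _ => μ) (Measure.pi fun _ => μ) := by
  induction n with
  | zero =>
    convert MeasurePreserving.id (Measure.pi fun _ : Fin 0 => μ) using 1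
  | succ n ih =>
    have e := measurePreserving_piFinSuccAbove (fun _ : Fin (n + 1) => μ) 0
    have key : MeasurePreserving
        (fun p : E × (Fin n → E) => (p.1, fun j => p.1 + ∑ i ∈ Finset.Iic j, p.2 i))
        (μ.prod (Measure.pi fun _ => μ)) (μ.prod (Measure.pi fun _ => μ)) := by
      refine MeasurePreserving.skew_product
        (g := fun (x : E) (v : Fin n → E) j => x + ∑ i ∈ Finset.Iic j, v i) (MeasurePreserving.id μ) ?_ ?_
      · refine measurable_pi_lambda _ fun j => ?_
        exact measurable_fst.add (Finset.measurable_sum _ fun i _ =>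
          (measurable_pi_apply i).comp measurable_snd)
      · refine Eventually.of_forall fun x => ?_
        have h2 := (measurePreserving_pi (fun _ : Fin n => μ) (fun _ => μ)
          (fun _ => measurePreserving_add_left μ x)).comp ih
        exact h2.map_eq
    convert (e.symm.comp key).comp e using 1
    ext u j
    simp only [Function.comp, MeasurableEquiv.piFinSuccAbove_symm_apply, Fin.insertNthEquiv,
      Equiv.coe_fn_mk, MeasurableEquiv.piFinSuccAbove_apply, Fin.insertNth_zero]
    refine Fin.cases ?_ (fun j => ?_) j
    · have : Finset.Iic (0 : Fin (n + 1)) = {0} := by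
        ext i; simp
      simp [this]
    · have : Finset.Iic (j.succ) = insert 0 ((Finset.Iic j).map (Fin.succEmb n)) := by
        ext i
        refine Fin.cases ?_ (fun i => ?_) i <;> simp
      rw [this, Finset.sum_insert (by simp), Finset.sum_map]
      rfl

/-- Taking partial sums from the right is a shear, hence preserves a translation invariant
product measure. -/
lemma measurePreserving_sum_Ici (n : ℕ) :
    MeasurePreserving (fun (u : Fin n → E) j => ∑ i ∈ Finset.Ici j, u i)
      (Measure.pi fun _ => μ) (Measure.pi fun _ => μ) := by
  have hr : MeasurePreserving (fun (u : Fin n → E) (j : Fin n) => u j.rev)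
      (Measure.pi fun _ => μ) (Measure.pi fun _ => μ) := by
    convert measurePreserving_arrowCongr' (fun _ : Fin n => μ) (fun _ => μ) Fin.revPerm
      (MeasurableEquiv.refl E) (fun _ => MeasurePreserving.id μ) using 1
    ext u j
    simp [MeasurableEquiv.arrowCongr', Equiv.arrowCongr']
  convert (hr.comp (measurePreserving_sum_Iic μ n)).comp hr using 1
  ext u j
  simp only [Function.comp]
  refine Finset.sum_nbij' Fin.rev Fin.rev ?_ ?_ ?_ ?_ ?_ <;> simp [Fin.le_rev_iff]

end PiMeasure

section Frequency

/-- Summation by parts in an inner product space, along a finite sequence started at `0`. -/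
lemma sum_inner_eq_sum_inner_sub {E : Type*} [NormedAddCommGroup E] [InnerProductSpace ℝ E]
    {m : ℕ} (u : Fin m → E) (y : Fin (m + 1) → E) (hy : y 0 = 0) :
    ∑ j, ⟪u j, y j.succ⟫ = ∑ j, ⟪∑ i ∈ Finset.Ici j, u i, y j.succ - y j.castSucc⟫ := by
  have tele : ∀ j : Fin m, y j.succ = ∑ i ∈ Finset.Iic j, (y i.succ - y i.castSucc) := by
    intro j
    have := Fin.sum_Iic_sub j y
    rw [this, hy, sub_zero]
  calc ∑ j, ⟪u j, y j.succ⟫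
      = ∑ j, ∑ i ∈ Finset.Iic j, ⟪u j, y i.succ - y i.castSucc⟫ := by
        refine Finset.sum_congr rfl fun j _ => ?_
        rw [← inner_sum, ← tele]
    _ = ∑ i, ∑ j ∈ Finset.Ici i, ⟪u j, y i.succ - y i.castSucc⟫ := by
        refine Finset.sum_comm' ?_
        simp
    _ = _ := by simp_rw [sum_inner]

/-- A product of norms is controlled by the norms of the partial sums from the right. -/
lemma prod_norm_le_prod_one_add_norm_sq {E : Type*} [NormedAddCommGroup E]
    {m : ℕ} (u : Fin m → E) :
    ∏ j, ‖u j‖ ≤ ∏ j, (1 + ‖∑ i ∈ Finset.Ici j, u i‖) ^ 2 := by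
  set g : Fin (m + 1) → E := fun j => ∑ i ∈ Finset.univ.filter (fun i : Fin m => j ≤ i.castSucc), u i
    with hg
  have g_cast : ∀ j : Fin m, g j.castSucc = ∑ i ∈ Finset.Ici j, u i := by
    intro j
    refine Finset.sum_congr ?_ fun _ _ => rfl
    ext i; simp
  have g_last : g (Fin.last m) = 0 := by
    refine Finset.sum_eq_zero fun i hi => ?_
    have h := (Finset.mem_filter.mp hi).2
    exact absurd h (not_le.mpr (Fin.castSucc_lt_last i))
  have u_eq : ∀ j : Fin m, u j = g j.castSucc - g j.succ := by
    intro j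
    rw [g_cast, eq_sub_iff_add_eq]
    have : Finset.Ici j = insert j (Finset.univ.filter (fun i : Fin m => j.succ ≤ i.castSucc)) := by
      ext i
      simp only [Finset.mem_Ici, Finset.mem_insert, Finset.mem_filter, Finset.mem_univ, true_and,
        Fin.le_def, Fin.ext_iff, Fin.val_succ, Fin.val_castSucc]
      omega
    rw [this, Finset.sum_insert (by simp [Fin.le_def])]
  set x : Fin (m + 1) → ℝ := fun j => 1 + ‖g j‖ with hx
  have x_one : ∀ j, 1 ≤ x j := fun j => by simp [hx]
  have x_nn : ∀ j, 0 ≤ x j := fun j => zero_le_one.trans (x_one j)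
  have h1 : ∀ j : Fin m, ‖u j‖ ≤ x j.castSucc * x j.succ := by
    intro j
    rw [u_eq]
    refine (norm_sub_le _ _).trans ?_
    simp only [hx]
    nlinarith [norm_nonneg (g j.castSucc), norm_nonneg (g j.succ),
      mul_nonneg (norm_nonneg (g j.castSucc)) (norm_nonneg (g j.succ))]
  have h2 : ∏ j : Fin m, x j.succ ≤ ∏ j : Fin m, x j.castSucc := by
    have e : x 0 * ∏ j : Fin m, x j.succ = ∏ j : Fin m, x j.castSucc := by
      rw [← Fin.prod_univ_succ, Fin.prod_univ_castSucc]
      simp [hx, g_last]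
    rw [← e]
    exact le_mul_of_one_le_left (Finset.prod_nonneg fun _ _ => x_nn _) (x_one 0)
  calc ∏ j, ‖u j‖ ≤ ∏ j : Fin m, (x j.castSucc * x j.succ) :=
        Finset.prod_le_prod (fun _ _ => norm_nonneg _) fun j _ => h1 j
    _ = (∏ j : Fin m, x j.castSucc) * ∏ j : Fin m, x j.succ := Finset.prod_mul_distrib
    _ ≤ (∏ j : Fin m, x j.castSucc) * ∏ j : Fin m, x j.castSucc :=
        mul_le_mul_of_nonneg_left h2 (Finset.prod_nonneg fun _ _ => x_nn _)
    _ = ∏ j, (1 + ‖∑ i ∈ Finset.Ici j, u i‖) ^ 2 := by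
        rw [← Finset.prod_mul_distrib]
        refine Finset.prod_congr rfl fun j _ => ?_
        rw [← g_cast]; ring

lemma one_add_norm_le_prod {d : ℕ} (x : Ed d) : 1 + ‖x‖ ≤ ∏ l, (1 + |x l|) := by
  have h1 : ‖x‖ ≤ ∑ l, |x l| := by
    rw [EuclideanSpace.norm_eq]
    refine Real.sqrt_le_iff.mpr ⟨Finset.sum_nonneg fun _ _ => abs_nonneg _, ?_⟩
    simp_rw [Real.norm_eq_abs]
    exact Finset.sum_sq_le_sq_sum_of_nonneg fun _ _ => abs_nonneg _
  have h2 : ∀ s : Finset (Fin d), 1 + ∑ l ∈ s, |x l| ≤ ∏ l ∈ s, (1 + |x l|) := by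
    intro s
    induction s using Finset.cons_induction with
    | empty => simp
    | cons a s ha ih =>
      rw [Finset.sum_cons, Finset.prod_cons]
      have := abs_nonneg (x a)
      have h3 : 0 ≤ ∑ l ∈ s, |x l| := Finset.sum_nonneg fun _ _ => abs_nonneg _
      nlinarith [mul_le_mul_of_nonneg_left ih this, mul_nonneg this h3]
  linarith [h2 Finset.univ]

/-- The weight obtained from the best of the two exponents `0` and `4`. -/
lemma exists_exponent_weight_le {D M p z : ℝ} (hD : 0 < D) (hDM : D ≤ M) (hp : 0 < p) (hp1 : p ≤ 1) :
    ∃ k : ℕ, (k = 0 ∨ k = 4) ∧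
      (1 + |z|) ^ p * (|z| ^ k)⁻¹ * (D ^ k)⁻¹ ≤ 16 * (1 + M) * D ^ (-p) * ((1 + D * |z|) ^ 3)⁻¹ := by
  have hM : 0 < M := hD.trans_le hDM
  have hz := abs_nonneg z
  have hw : 0 ≤ D * |z| := by positivity
  have h1 : (1 + |z|) ^ p ≤ (1 + M) * D ^ (-p) * (1 + D * |z|) := by
    have a1 : 1 + |z| ≤ ((1 + M) * (1 + D * |z|)) * D⁻¹ := by
      rw [le_mul_inv_iff₀ hD]
      nlinarith [mul_nonneg hM.le hw]
    calc (1 + |z|) ^ p ≤ (((1 + M) * (1 + D * |z|)) * D⁻¹) ^ p :=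
          Real.rpow_le_rpow (by positivity) a1 hp.le
      _ = ((1 + M) * (1 + D * |z|)) ^ p * D ^ (-p) := by
          rw [Real.mul_rpow (by positivity) (by positivity), Real.inv_rpow hD.le, Real.rpow_neg hD.le]
      _ ≤ ((1 + M) * (1 + D * |z|)) * D ^ (-p) := by
          refine mul_le_mul_of_nonneg_right ?_ (by positivity)
          refine Real.rpow_le_self_of_one_le ?_ hp1
          nlinarith [mul_nonneg hM.le hw]
      _ = _ := by ring
  have h2 : ∃ k : ℕ, (k = 0 ∨ k = 4) ∧ (|z| ^ k)⁻¹ * (D ^ k)⁻¹ ≤ 16 * ((1 + D * |z|) ^ 4)⁻¹ := by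
    by_cases h : 1 ≤ D * |z|
    · refine ⟨4, Or.inr rfl, ?_⟩
      rw [← mul_inv, ← mul_pow, mul_comm |z| D]
      rw [show (16 : ℝ) * ((1 + D * |z|) ^ 4)⁻¹ = (((1 + D * |z|) / 2) ^ 4)⁻¹ by
        rw [div_pow, inv_div]; ring]
      gcongr
      linarith
    · refine ⟨0, Or.inl rfl, ?_⟩
      push Not at h
      rw [show (16 : ℝ) * ((1 + D * |z|) ^ 4)⁻¹ = (((1 + D * |z|) / 2) ^ 4)⁻¹ by
        rw [div_pow, inv_div]; ring]
      simp only [pow_zero, inv_one, mul_one]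
      refine (one_le_inv₀ (by positivity)).mpr (pow_le_one₀ (by positivity) (by linarith))
  obtain ⟨k, hk, hk2⟩ := h2
  refine ⟨k, hk, ?_⟩
  rw [mul_assoc]
  calc (1 + |z|) ^ p * ((|z| ^ k)⁻¹ * (D ^ k)⁻¹)
      ≤ ((1 + M) * D ^ (-p) * (1 + D * |z|)) * (16 * ((1 + D * |z|) ^ 4)⁻¹) := by gcongr
    _ = _ := by
      have : 1 + D * |z| ≠ 0 := by positivity
      field_simp

lemma lintegral_one_add_mul_abs {D : ℝ} (hD : 0 < D) :
    ∫⁻ z : ℝ, ENNReal.ofReal (((1 + D * |z|) ^ 3)⁻¹)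
      = ENNReal.ofReal D⁻¹ * ∫⁻ z : ℝ, ENNReal.ofReal (((1 + |z|) ^ 3)⁻¹) := by
  have hm : Measurable fun z : ℝ => ENNReal.ofReal (((1 + |z|) ^ 3)⁻¹) := by fun_prop
  have := Real.smul_map_volume_mul_left hD.ne'
  conv_rhs => rw [← this]
  rw [lintegral_smul_measure, lintegral_map hm (measurable_const_mul D), smul_eq_mul, ← mul_assoc,
    abs_of_pos hD, ← ENNReal.ofReal_mul (by positivity), inv_mul_cancel₀ hD.ne', ENNReal.ofReal_one,
    one_mul]
  simp_rw [abs_mul, abs_of_pos hD]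

lemma lintegral_one_add_abs_lt_top : ∫⁻ z : ℝ, ENNReal.ofReal (((1 + |z|) ^ 3)⁻¹) < ∞ := by
  have h : Integrable (fun x : ℝ => (1 + ‖x‖) ^ (-(3 : ℝ))) :=
    integrable_one_add_norm (by norm_num)
  refine lt_of_eq_of_lt ?_ h.lintegral_lt_top
  refine lintegral_congr fun z => ?_
  rw [Real.rpow_neg (by positivity), Real.norm_eq_abs]
  norm_cast

/-- Tonelli's theorem for a product of functions of the coordinates on Euclidean space. -/
lemma lintegral_euclidean_prod {d : ℕ} (f : ℝ → ℝ≥0∞) (hf : Measurable f) :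
    ∫⁻ x : Ed d, ∏ l, f (x l) = (∫⁻ z, f z) ^ d := by
  have h := (PiLp.volume_preserving_ofLp (Fin d)).lintegral_comp
    (f := fun y : Fin d → ℝ => ∏ l, f (y l))
    (Finset.measurable_prod _ fun i _ => hf.comp (measurable_pi_apply i))
  refine h.trans ?_
  rw [volume_pi, lintegral_fin_prod_eq_prod volume (fun _ => f) (fun _ => hf)]
  simp

lemma ae_coord_ne_zero (m d : ℕ) :
    ∀ᵐ ξ ∂(Measure.pi fun _ : Fin m => (volume : Measure (Ed d))), ∀ j l, ξ j l ≠ 0 := by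
  rw [ae_all_iff]; intro j
  rw [ae_all_iff]; intro l
  have h0 : ∀ᵐ z : ℝ, z ≠ 0 := by simp [ae_iff]
  have h1 : ∀ᵐ y : Fin d → ℝ, y l ≠ 0 :=
    (Measure.quasiMeasurePreserving_eval (fun _ : Fin d => (volume : Measure ℝ)) l).ae h0
  have h2 : ∀ᵐ x : Ed d, x l ≠ 0 :=
    (PiLp.volume_preserving_ofLp (Fin d)).quasiMeasurePreserving.ae h1
  exact (Measure.quasiMeasurePreserving_eval (fun _ : Fin m => (volume : Measure (Ed d))) j).ae h2

end Frequency

section OrderedTimes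

variable {Ω : Type*} [MeasurableSpace Ω] {d : ℕ} {P : Measure Ω}
  {Y : ℝ → Ω → Ed d} {T α θ p : ℝ}

/-- Pointwise form of the decay of the characteristic function of the process at ordered times. -/
lemma exists_prod_norm_mul_norm_charFun_le (hα : 0 < α) (hp : 0 < p) (hp1 : p ≤ 1)
    (hA1 : CondA1 P Y T α θ) (hY0 : ∀ ω, Y 0 ω = 0) {m : ℕ} (hm : 0 < m) :
    ∃ K : ℝ, 0 < K ∧ ∀ t : Fin m → ℝ, StrictMono (Fin.cons 0 t : Fin (m + 1) → ℝ) →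
      (∀ j, t j < T) → ∀ u : Fin m → Ed d, (∀ j l, (∑ i ∈ Finset.Ici j, u i) l ≠ 0) →
      (∏ j, ‖u j‖ ^ (p / 2)) * ‖∫ ω, Complex.exp (Complex.I * Complex.ofReal
          (∑ j, ⟪u j, Y (t j) ω⟫)) ∂P‖ ≤
        K * ∏ j, ∏ l, (16 * (1 + T ^ α) *
          ((t j - (Fin.cons 0 t : Fin (m + 1) → ℝ) j.castSucc) ^ α) ^ (-p) *
          ((1 + (t j - (Fin.cons 0 t : Fin (m + 1) → ℝ) j.castSucc) ^ α *
            |(∑ i ∈ Finset.Ici j, u i) l|) ^ 3)⁻¹) := by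
  obtain ⟨C, hC, hA⟩ := hA1
  have hm' : (0 : ℝ) < m := by exact_mod_cast hm
  refine ⟨C ^ m * (m : ℝ) ^ (α * θ * (m : ℝ)), by positivity, fun t ht htT u hu => ?_⟩
  set t' : Fin (m + 1) → ℝ := Fin.cons 0 t with ht'
  set ξ : Fin m → Ed d := fun j => ∑ i ∈ Finset.Ici j, u i with hξ
  have succ_eq : ∀ j : Fin m, t' j.succ = t j := fun j => by simp [ht']
  set D : Fin m → ℝ := fun j => (t j - t' j.castSucc) ^ α with hDdef
  have hΔ : ∀ j : Fin m, 0 < t j - t' j.castSucc := fun j => by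
    rw [← succ_eq]; exact sub_pos.mpr (ht Fin.castSucc_lt_succ)
  have t'_nonneg : ∀ j, 0 ≤ t' j := fun j => by
    have := ht.monotone (Fin.zero_le j); simpa [ht'] using this
  have hD : ∀ j, 0 < D j := fun j => Real.rpow_pos_of_pos (hΔ j) _
  have hDM : ∀ j, D j ≤ T ^ α := fun j => by
    refine Real.rpow_le_rpow (hΔ j).le ?_ hα.le
    have := t'_nonneg j.castSucc
    linarith [htT j]
  choose k hk hkle using fun j l =>
    exists_exponent_weight_le (z := ξ j l) (hD j) (hDM j) hp hp1
  have hlast : t' (Fin.last m) < T := by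
    obtain ⟨n, rfl⟩ := Nat.exists_eq_succ_of_ne_zero hm.ne'
    rw [← Fin.succ_last, succ_eq]; exact htT _
  have hchar := hA m hm ξ hu t' ht (by simp [ht']) hlast k hk
  have hsum : ∀ ω, ∑ j, ⟪u j, Y (t j) ω⟫ =
      ∑ j, ⟪ξ j, Y (t' j.succ) ω - Y (t' j.castSucc) ω⟫ := fun ω => by
    have := sum_inner_eq_sum_inner_sub u (fun j => Y (t' j) ω) (by simp [ht', hY0])
    simpa only [succ_eq] using this
  simp_rw [hsum]
  have hnorm : ∏ j, ‖u j‖ ^ (p / 2) ≤ ∏ j, ∏ l, (1 + |ξ j l|) ^ p := by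
    calc ∏ j, ‖u j‖ ^ (p / 2) = (∏ j, ‖u j‖) ^ (p / 2) :=
          Real.finsetProd_rpow _ _ (fun _ _ => norm_nonneg _) _
      _ ≤ (∏ j, (1 + ‖ξ j‖) ^ 2) ^ (p / 2) :=
          Real.rpow_le_rpow (Finset.prod_nonneg fun _ _ => norm_nonneg _)
            (prod_norm_le_prod_one_add_norm_sq u) (by positivity)
      _ = ∏ j, (1 + ‖ξ j‖) ^ p := by
          rw [← Real.finsetProd_rpow _ _ (fun _ _ => by positivity)]
          refine Finset.prod_congr rfl fun j _ => ?_
          rw [← Real.rpow_natCast, ← Real.rpow_mul (by positivity)]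
          congr 1
          push_cast; ring
      _ ≤ ∏ j, ∏ l, (1 + |ξ j l|) ^ p := by
          refine Finset.prod_le_prod (fun _ _ => by positivity) fun j _ => ?_
          rw [Real.finsetProd_rpow _ _ (fun _ _ => by positivity)]
          exact Real.rpow_le_rpow (by positivity) (one_add_norm_le_prod _) hp.le
  have hrp : ∀ j l, (t' j.succ - t' j.castSucc) ^ (α * (k j l : ℝ)) = D j ^ k j l := by
    intro j l
    rw [succ_eq, Real.rpow_mul (hΔ j).le, Real.rpow_natCast]
  simp_rw [hrp] at hchar
  calc _ ≤ (∏ j, ∏ l, (1 + |ξ j l|) ^ p) * (C ^ m * (m : ℝ) ^ (α * θ * (m : ℝ)) *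
              ∏ j, ∏ l, (|ξ j l| ^ (k j l))⁻¹ * (D j ^ k j l)⁻¹) := by
        refine mul_le_mul hnorm hchar (norm_nonneg _) ?_
        exact Finset.prod_nonneg fun _ _ => Finset.prod_nonneg fun _ _ => by positivity
    _ = C ^ m * (m : ℝ) ^ (α * θ * (m : ℝ)) *
          ∏ j, ∏ l, ((1 + |ξ j l|) ^ p * (|ξ j l| ^ (k j l))⁻¹ * (D j ^ k j l)⁻¹) := by
        rw [mul_left_comm]
        congr 1
        rw [← Finset.prod_mul_distrib]
        refine Finset.prod_congr rfl fun j _ => ?_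
        rw [← Finset.prod_mul_distrib]
        refine Finset.prod_congr rfl fun l _ => ?_
        ring
    _ ≤ _ := by
        refine mul_le_mul_of_nonneg_left ?_ (by positivity)
        refine Finset.prod_le_prod (fun j _ => Finset.prod_nonneg fun l _ => ?_) fun j _ => ?_
        · have := hD j
          positivity
        · refine Finset.prod_le_prod (fun l _ => ?_) fun l _ => hkle j l
          have := hD j
          positivity

/-- Integrated form of the decay of the characteristic function at ordered times. -/
lemma exists_lintegral_norm_mul_charFun_le (hT : 0 < T) (hα : 0 < α) (hp : 0 < p) (hp1 : p ≤ 1)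
    (hA1 : CondA1 P Y T α θ) (hY0 : ∀ ω, Y 0 ω = 0) {m : ℕ} (hm : 0 < m) :
    ∃ K : ℝ≥0∞, K ≠ ∞ ∧ ∀ t : Fin m → ℝ, StrictMono (Fin.cons 0 t : Fin (m + 1) → ℝ) →
      (∀ j, t j < T) →
      ∫⁻ u, ENNReal.ofReal ((∏ j, ‖u j‖ ^ (p / 2)) * ‖∫ ω, Complex.exp (Complex.I * Complex.ofReal
          (∑ j, ⟪u j, Y (t j) ω⟫)) ∂P‖) ∂(Measure.pi fun _ : Fin m => (volume : Measure (Ed d))) ≤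
        K * ∏ j, ENNReal.ofReal (t j - (Fin.cons 0 t : Fin (m + 1) → ℝ) j.castSucc) ^
          (-(α * d * (1 + p))) := by
  obtain ⟨K, hK, hle⟩ := exists_prod_norm_mul_norm_charFun_le hα hp hp1 hA1 hY0 hm
  set c : ℝ≥0∞ := ∫⁻ z : ℝ, ENNReal.ofReal (((1 + |z|) ^ 3)⁻¹) with hc
  have hcfin : c ≠ ∞ := lintegral_one_add_abs_lt_top.ne
  refine ⟨ENNReal.ofReal K * ((ENNReal.ofReal (16 * (1 + T ^ α)) * c) ^ d) ^ m, ?_,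
    fun t ht htT => ?_⟩
  · finiteness
  set t' : Fin (m + 1) → ℝ := Fin.cons 0 t with ht'
  have hΔ : ∀ j : Fin m, 0 < t j - t' j.castSucc := fun j => by
    have : t' j.succ = t j := by simp [ht']
    rw [← this]; exact sub_pos.mpr (ht Fin.castSucc_lt_succ)
  set D : Fin m → ℝ := fun j => (t j - t' j.castSucc) ^ α with hDdef
  have hD : ∀ j, 0 < D j := fun j => Real.rpow_pos_of_pos (hΔ j) _
  set W : Fin m → ℝ → ℝ := fun j z => 16 * (1 + T ^ α) * D j ^ (-p) * ((1 + D j * |z|) ^ 3)⁻¹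
    with hW
  have hW0 : ∀ j z, 0 ≤ W j z := fun j z => by have := hD j; positivity
  have hWm : ∀ j, Measurable fun z => ENNReal.ofReal (W j z) := fun j => by
    simp only [hW]; fun_prop
  have hWint : ∀ j, (∫⁻ z, ENNReal.ofReal (W j z)) =
      (ENNReal.ofReal (16 * (1 + T ^ α)) * c) * ENNReal.ofReal (D j ^ (-(1 + p))) := by
    intro j
    have h0 : 0 ≤ 16 * (1 + T ^ α) * D j ^ (-p) := by have := hD j; positivity
    simp only [hW]
    simp_rw [ENNReal.ofReal_mul h0]
    rw [lintegral_const_mul _ (by fun_prop), lintegral_one_add_mul_abs (hD j), ← hc,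
      ENNReal.ofReal_mul (by positivity), neg_add, Real.rpow_add (hD j), Real.rpow_neg_one,
      ENNReal.ofReal_mul (inv_nonneg.mpr (hD j).le)]
    ring
  have hF : Measurable fun ξ : Fin m → Ed d => ∏ j, ∏ l, ENNReal.ofReal (W j (ξ j l)) :=
    Finset.measurable_prod _ fun j _ => Finset.measurable_prod _ fun l _ => (hWm j).comp <| by
      fun_prop
  have hS := measurePreserving_sum_Ici (volume : Measure (Ed d)) m
  calc _ ≤ ∫⁻ u, ENNReal.ofReal K * (∏ j, ∏ l, ENNReal.ofReal
          (W j ((∑ i ∈ Finset.Ici j, u i : Ed d) l))) ∂(Measure.pi fun _ => volume) := by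
        refine lintegral_mono_ae ?_
        filter_upwards [hS.quasiMeasurePreserving.ae (ae_coord_ne_zero m d)] with u hu
        refine (ENNReal.ofReal_le_ofReal (hle t ht htT u hu)).trans ?_
        rw [ENNReal.ofReal_mul hK.le, ENNReal.ofReal_prod_of_nonneg
          (fun j _ => Finset.prod_nonneg fun l _ => hW0 _ _)]
        refine le_of_eq ?_
        congr 1
        refine Finset.prod_congr rfl fun j _ => ?_
        rw [ENNReal.ofReal_prod_of_nonneg (fun l _ => hW0 _ _)]
    _ = ENNReal.ofReal K * ∫⁻ ξ : Fin m → Ed d, (∏ j, ∏ l, ENNReal.ofReal (W j (ξ j l)))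
          ∂(Measure.pi fun _ => volume) := by
        rw [← hS.lintegral_comp hF]
        exact lintegral_const_mul _ (hF.comp hS.measurable)
    _ = ENNReal.ofReal K * ∏ j, ((ENNReal.ofReal (16 * (1 + T ^ α)) * c) *
          ENNReal.ofReal (D j ^ (-(1 + p)))) ^ d := by
        congr 1
        rw [lintegral_fin_prod_eq_prod volume
          (fun j (x : Ed d) => ∏ l, ENNReal.ofReal (W j (x l)))
          (fun j => Finset.measurable_prod _ fun l _ => (hWm j).comp (by fun_prop))]
        refine Finset.prod_congr rfl fun j _ => ?_
        rw [lintegral_euclidean_prod _ (hWm j), hWint]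
    _ = _ := by
        simp_rw [mul_pow _ (ENNReal.ofReal _) d, Finset.prod_mul_distrib]
        simp only [Finset.prod_const, Finset.card_univ, Fintype.card_fin]
        rw [mul_assoc]
        congr 2
        refine Finset.prod_congr rfl fun j _ => ?_
        rw [ENNReal.ofReal_rpow_of_pos (hΔ j), ← ENNReal.ofReal_pow (by have := hD j; positivity)]
        congr 1
        rw [← Real.rpow_natCast, ← Real.rpow_mul (hΔ j).le, ← Real.rpow_mul (hΔ j).le]
        congr 1
        ring

end OrderedTimes

section TimeIntegral

lemma lintegral_Icc_enorm_rpow_neg_le {κ h : ℝ} (hκ : κ < 1) (hh : 0 < h) :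
    ∫⁻ x in Icc (-h) h, ‖x‖ₑ ^ (-κ) ≤ 2 * ENNReal.ofReal (1 - κ)⁻¹ * ENNReal.ofReal h ^ (1 - κ) := by
  have hpos : ∫⁻ x in Ioc 0 h, ‖x‖ₑ ^ (-κ) = ENNReal.ofReal (1 - κ)⁻¹ * ENNReal.ofReal h ^ (1 - κ) := by
    have hint : IntegrableOn (fun x : ℝ => x ^ (-κ)) (Ioc 0 h) := by
      rw [← intervalIntegrable_iff_integrableOn_Ioc_of_le hh.le]
      exact intervalIntegral.intervalIntegrable_rpow' (by linarith)
    have heq : ∫⁻ x in Ioc 0 h, ‖x‖ₑ ^ (-κ) = ∫⁻ x in Ioc 0 h, ENNReal.ofReal (x ^ (-κ)) := by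
      refine setLIntegral_congr_fun measurableSet_Ioc fun x hx => ?_
      rw [Real.enorm_eq_ofReal hx.1.le, ENNReal.ofReal_rpow_of_pos hx.1]
    rw [heq, ← ofReal_integral_eq_lintegral_ofReal hint
      ((ae_restrict_iff' measurableSet_Ioc).mpr
        (Eventually.of_forall fun x hx => Real.rpow_nonneg hx.1.le _)),
      ← intervalIntegral.integral_of_le hh.le, integral_rpow (Or.inl (by linarith)),
      Real.zero_rpow (by linarith), ENNReal.ofReal_rpow_of_pos hh, ← ENNReal.ofReal_mul (by
        rw [inv_nonneg]; linarith)]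
    congr 1
    rw [show -κ + 1 = 1 - κ by ring]
    field_simp
    ring
  have hneg : ∫⁻ x in Ico (-h) 0, ‖x‖ₑ ^ (-κ) = ∫⁻ x in Ioc 0 h, ‖x‖ₑ ^ (-κ) := by
    have := (Measure.measurePreserving_neg (volume : Measure ℝ)).setLIntegral_comp_preimage
      (s := Ioc 0 h) measurableSet_Ioc (f := fun x : ℝ => ‖x‖ₑ ^ (-κ)) (by fun_prop)
    simpa using this
  have hsub : Icc (-h) h ⊆ (Ico (-h) 0 ∪ {0}) ∪ Ioc 0 h := by
    intro x hx
    rcases lt_trichotomy x 0 with h0 | h0 | h0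
    · exact Or.inl (Or.inl ⟨hx.1, h0⟩)
    · exact Or.inl (Or.inr h0)
    · exact Or.inr ⟨h0, hx.2⟩
  calc ∫⁻ x in Icc (-h) h, ‖x‖ₑ ^ (-κ)
      ≤ ∫⁻ x in (Ico (-h) 0 ∪ {0}) ∪ Ioc 0 h, ‖x‖ₑ ^ (-κ) := lintegral_mono_set hsub
    _ ≤ (∫⁻ x in Ico (-h) 0, ‖x‖ₑ ^ (-κ)) + (∫⁻ x in ({0} : Set ℝ), ‖x‖ₑ ^ (-κ))
          + ∫⁻ x in Ioc 0 h, ‖x‖ₑ ^ (-κ) :=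
        (lintegral_union_le _ _ _).trans (add_le_add_left (lintegral_union_le _ _ _) _)
    _ = _ := by
        rw [hneg, hpos, Measure.restrict_singleton]
        simp only [Real.volume_singleton, zero_smul, lintegral_zero_measure, add_zero]
        ring

/-- The integral over a cube of a product of negative powers of consecutive differences. -/
lemma lintegral_prod_enorm_sub_rpow_le {κ a b : ℝ} (hκ : κ < 1) (hab : a < b) (m : ℕ) :
    ∫⁻ t, ∏ j, ‖t j - (Fin.cons a t : Fin (m + 1) → ℝ) j.castSucc‖ₑ ^ (-κ)
        ∂(Measure.pi fun _ : Fin m => (volume : Measure ℝ).restrict (Ico a b)) ≤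
      (2 * ENNReal.ofReal (1 - κ)⁻¹ * ENNReal.ofReal (b - a) ^ (1 - κ)) ^ m := by
  set Q : (Fin m → ℝ) → Fin m → ℝ := fun δ j => a + ∑ i ∈ Finset.Iic j, δ i with hQ
  have hQmp : MeasurePreserving Q (Measure.pi fun _ => volume) (Measure.pi fun _ => volume) :=
    (measurePreserving_pi (fun _ : Fin m => (volume : Measure ℝ)) (fun _ => volume)
      (fun _ => measurePreserving_add_left volume a)).comp
      (measurePreserving_sum_Iic (volume : Measure ℝ) m)
  set G : (Fin m → ℝ) → ℝ≥0∞ :=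
    fun t => ∏ j, ‖t j - (Fin.cons a t : Fin (m + 1) → ℝ) j.castSucc‖ₑ ^ (-κ) with hG
  have hGm : Measurable G := by
    refine Finset.measurable_prod _ fun j _ => Measurable.pow_const ?_ _
    refine (Measurable.sub (measurable_pi_apply j) ?_).enorm
    cases m with
    | zero => exact j.elim0
    | succ n =>
      refine Fin.cases ?_ (fun j => ?_) j
      · simp
      · simp only [← Fin.succ_castSucc, Fin.cons_succ]; fun_prop
  have hbox : MeasurableSet (univ.pi fun _ : Fin m => Ico a b) :=
    MeasurableSet.univ_pi fun _ => measurableSet_Ico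
  have hdiff : ∀ δ : Fin m → ℝ, ∀ j, Q δ j - (Fin.cons a (Q δ) : Fin (m + 1) → ℝ) j.castSucc = δ j := by
    intro δ j
    cases m with
    | zero => exact j.elim0
    | succ n =>
      refine Fin.cases ?_ (fun j => ?_) j
      · have : Finset.Iic (0 : Fin (n + 1)) = {0} := by ext i; simp
        simp [hQ, this]
      · simp only [← Fin.succ_castSucc, Fin.cons_succ, hQ]
        have : Finset.Iic j.succ = insert j.succ (Finset.Iic j.castSucc) := by
          ext i
          simp only [Finset.mem_Iic, Finset.mem_insert, Fin.le_def, Fin.ext_iff, Fin.val_succ,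
            Fin.val_castSucc]
          omega
        rw [this, Finset.sum_insert (by simp [Fin.le_def])]
        ring
  rw [← Measure.restrict_pi_pi, ← lintegral_indicator hbox, ← hQmp.lintegral_comp (hGm.indicator hbox)]
  calc _ ≤ ∫⁻ δ : Fin m → ℝ, ∏ j, (Icc (-(b - a)) (b - a)).indicator (fun x => ‖x‖ₑ ^ (-κ)) (δ j)
          ∂(Measure.pi fun _ => volume) := by
        refine lintegral_mono fun δ => ?_
        by_cases h : Q δ ∈ univ.pi fun _ : Fin m => Ico a b
        · rw [indicator_of_mem h]
          refine Finset.prod_le_prod' fun j _ => ?_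
          have hmem : δ j ∈ Icc (-(b - a)) (b - a) := by
            rw [← hdiff δ j]
            have h1 := h j (mem_univ j)
            have h2 : (Fin.cons a (Q δ) : Fin (m + 1) → ℝ) j.castSucc ∈ Ico a b := by
              refine Fin.cases ?_ (fun i => ?_) j.castSucc
              · simpa using hab
              · simpa only [Fin.cons_succ] using h i (mem_univ i)
            constructor <;> linarith [h1.1, h1.2, h2.1, h2.2]
          rw [indicator_of_mem hmem, hdiff]
        · rw [indicator_of_notMem h]; exact zero_le
    _ = (∫⁻ x in Icc (-(b - a)) (b - a), ‖x‖ₑ ^ (-κ)) ^ m := by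
        rw [lintegral_fin_prod_eq_prod volume
          (fun _ => (Icc (-(b - a)) (b - a)).indicator (fun x : ℝ => ‖x‖ₑ ^ (-κ)))
          (fun _ => Measurable.indicator (by fun_prop) measurableSet_Icc)]
        simp [lintegral_indicator measurableSet_Icc]
    _ ≤ _ := by
        gcongr
        exact lintegral_Icc_enorm_rpow_neg_le hκ (sub_pos.mpr hab)

end TimeIntegral

section Moments

variable {Ω : Type*} [MeasurableSpace Ω] {d : ℕ} {P : Measure Ω} [IsProbabilityMeasure P]
  {Y : ℝ → Ω → Ed d} {T α θ p : ℝ}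

/-- The mixed moments of a Fourier integral of the process, in terms of characteristic functions. -/
lemma enorm_integral_prod_le (hYm : ∀ t, Measurable (Y t)) {A : ℝ} (hA : 0 ≤ A)
    {ψ : Ed d → ℝ} {a : Ed d → ℂ} (ha : Integrable a)
    (hψ : ∀ y, (ψ y : ℂ) = ∫ u, a u * Complex.exp (Complex.I * Complex.ofReal ⟪u, y⟫))
    (haA : ∀ u, ‖a u‖ ≤ A * ‖u‖ ^ (p / 2)) {m : ℕ} (t : Fin m → ℝ) :
    ‖∫ ω, ∏ j, ψ (Y (t j) ω) ∂P‖ₑ ≤ ENNReal.ofReal A ^ m *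
      ∫⁻ u, ENNReal.ofReal ((∏ j, ‖u j‖ ^ (p / 2)) * ‖∫ ω, Complex.exp (Complex.I * Complex.ofReal
          (∑ j, ⟪u j, Y (t j) ω⟫)) ∂P‖) ∂(Measure.pi fun _ : Fin m => (volume : Measure (Ed d))) := by
  set ν := Measure.pi fun _ : Fin m => (volume : Measure (Ed d)) with hν
  have hexp : ∀ (ω : Ω) (u : Fin m → Ed d),
      ∏ j, (a (u j) * Complex.exp (Complex.I * Complex.ofReal ⟪u j, Y (t j) ω⟫)) =
      (∏ j, a (u j)) * Complex.exp (Complex.I * Complex.ofReal (∑ j, ⟪u j, Y (t j) ω⟫)) := by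
    intro ω u
    rw [Finset.prod_mul_distrib, ← Complex.exp_sum, Complex.ofReal_sum, Finset.mul_sum]
  have h1 : ∀ ω, ((∏ j, ψ (Y (t j) ω) : ℝ) : ℂ) = ∫ u, (∏ j, a (u j)) *
      Complex.exp (Complex.I * Complex.ofReal (∑ j, ⟪u j, Y (t j) ω⟫)) ∂ν := by
    intro ω
    simp_rw [← hexp]
    rw [hν, integral_fintype_prod_eq_prod
      (fun j u => a u * Complex.exp (Complex.I * Complex.ofReal ⟪u, Y (t j) ω⟫))]
    push_cast
    exact Finset.prod_congr rfl fun j _ => hψ _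
  have hmeas : Measurable fun q : Ω × (Fin m → Ed d) =>
      Complex.exp (Complex.I * Complex.ofReal (∑ j, ⟪q.2 j, Y (t j) q.1⟫)) := by
    have : Measurable fun q : Ω × (Fin m → Ed d) => ∑ j, (⟪q.2 j, Y (t j) q.1⟫ : ℝ) :=
      Finset.measurable_sum _ fun j _ => Measurable.inner (by fun_prop)
        ((hYm (t j)).comp measurable_fst)
    fun_prop
  have hint : Integrable (fun q : Ω × (Fin m → Ed d) => (∏ j, a (q.2 j)) *
      Complex.exp (Complex.I * Complex.ofReal (∑ j, ⟪q.2 j, Y (t j) q.1⟫))) (P.prod ν) := by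
    have hi : Integrable (fun q : Ω × (Fin m → Ed d) => ∏ j, a (q.2 j)) (P.prod ν) :=
      (Integrable.fintype_prod (f := fun _ : Fin m => a) (μ := fun _ => volume)
        (fun _ => ha)).comp_snd P
    refine hi.mul_bdd (c := 1) hmeas.aestronglyMeasurable (Eventually.of_forall fun q => ?_)
    rw [mul_comm, Complex.norm_exp_ofReal_mul_I]
  have h2 : ((∫ ω, ∏ j, ψ (Y (t j) ω) ∂P : ℝ) : ℂ) = ∫ u, (∏ j, a (u j)) *
      (∫ ω, Complex.exp (Complex.I * Complex.ofReal (∑ j, ⟪u j, Y (t j) ω⟫)) ∂P) ∂ν := by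
    rw [← integral_complex_ofReal]
    simp_rw [h1]
    rw [integral_integral_swap hint]
    simp_rw [integral_const_mul]
  have h3 : ‖∫ ω, ∏ j, ψ (Y (t j) ω) ∂P‖ₑ = ‖((∫ ω, ∏ j, ψ (Y (t j) ω) ∂P : ℝ) : ℂ)‖ₑ := by
    rw [← ofReal_norm, ← ofReal_norm, Complex.norm_real]
  rw [h3, h2]
  refine (enorm_integral_le_lintegral_enorm _).trans ?_
  rw [← lintegral_const_mul' _ _ (by finiteness)]
  refine lintegral_mono fun u => ?_
  rw [← ofReal_norm, ← ENNReal.ofReal_pow hA, ← ENNReal.ofReal_mul (by positivity)]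
  refine ENNReal.ofReal_le_ofReal ?_
  rw [norm_mul, norm_prod, ← mul_assoc]
  refine mul_le_mul_of_nonneg_right ?_ (norm_nonneg _)
  calc ∏ j, ‖a (u j)‖ ≤ ∏ j, (A * ‖u j‖ ^ (p / 2)) :=
        Finset.prod_le_prod (fun _ _ => norm_nonneg _) fun j _ => haA _
    _ = _ := by rw [Finset.prod_mul_distrib]; simp

/-- Bound on the mixed moments in terms of the consecutive differences of the ordered times. -/
lemma exists_enorm_integral_prod_le_sum_perm (hT : 0 < T) (hα : 0 < α) (hp : 0 < p) (hp1 : p ≤ 1)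
    (hd : 0 < d) (hYm : ∀ t, Measurable (Y t)) (hA1 : CondA1 P Y T α θ) (hY0 : ∀ ω, Y 0 ω = 0)
    {m : ℕ} (hm : 0 < m) :
    ∃ K : ℝ≥0∞, K ≠ ∞ ∧ ∀ (A : ℝ) (ψ : Ed d → ℝ) (a : Ed d → ℂ), 0 < A → Integrable a →
      (∀ y, (ψ y : ℂ) = ∫ u, a u * Complex.exp (Complex.I * Complex.ofReal ⟪u, y⟫)) →
      (∀ u, ‖a u‖ ≤ A * ‖u‖ ^ (p / 2)) →
      ∀ (t₀ : ℝ) (t : Fin m → ℝ), 0 ≤ t₀ → (∀ j, t₀ ≤ t j) → (∀ j, t j < T) →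
      ‖∫ ω, ∏ j, ψ (Y (t j) ω) ∂P‖ₑ ≤ K * ENNReal.ofReal A ^ m * ∑ σ : Equiv.Perm (Fin m),
        ∏ j, ‖t (σ j) - (Fin.cons t₀ (t ∘ σ) : Fin (m + 1) → ℝ) j.castSucc‖ₑ ^
          (-(α * d * (1 + p))) := by
  obtain ⟨K, hK, hKle⟩ := exists_lintegral_norm_mul_charFun_le hT hα hp hp1 hA1 hY0 hm
  have hκ : 0 < α * d * (1 + p) := by positivity
  refine ⟨K + 1, by finiteness, fun A ψ a hA ha hψ haA t₀ t ht₀ htt₀ htT => ?_⟩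
  set σ := Tuple.sort t with hσ
  have hmono : Monotone (t ∘ σ) := Tuple.monotone_sort t
  refine le_trans ?_ (mul_le_mul_right (Finset.single_le_sum (fun _ _ => zero_le)
    (Finset.mem_univ σ)) _)
  have hperm : ∀ ω, ∏ j, ψ (Y (t j) ω) = ∏ j, ψ (Y ((t ∘ σ) j) ω) := fun ω =>
    (Equiv.prod_comp σ fun j => ψ (Y (t j) ω)).symm
  simp_rw [hperm]
  set s := t ∘ σ with hs
  have hs₀ : ∀ j, t₀ ≤ s j := fun j => htt₀ _
  have hsT : ∀ j, s j < T := fun j => htT _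
  change _ ≤ _ * ∏ j, ‖s j - (Fin.cons t₀ s : Fin (m + 1) → ℝ) j.castSucc‖ₑ ^ _
  have hcmp : ∀ j : Fin m, ENNReal.ofReal (s j - (Fin.cons 0 s : Fin (m + 1) → ℝ) j.castSucc) ^
      (-(α * d * (1 + p))) ≤
      ‖s j - (Fin.cons t₀ s : Fin (m + 1) → ℝ) j.castSucc‖ₑ ^ (-(α * d * (1 + p))) := by
    intro j
    rw [ENNReal.rpow_neg, ENNReal.rpow_neg, ENNReal.inv_le_inv]
    refine ENNReal.rpow_le_rpow ?_ hκ.le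
    obtain ⟨n, rfl⟩ := Nat.exists_eq_succ_of_ne_zero hm.ne'
    refine Fin.cases ?_ (fun j => ?_) j
    · simp only [Fin.castSucc_zero, Fin.cons_zero]
      rw [Real.enorm_eq_ofReal (by linarith [hs₀ 0])]
      exact ENNReal.ofReal_le_ofReal (by linarith)
    · simp only [← Fin.succ_castSucc, Fin.cons_succ]
      rw [Real.enorm_eq_ofReal (sub_nonneg.mpr (hmono Fin.castSucc_lt_succ.le))]
  by_cases hstrict : StrictMono (Fin.cons 0 s : Fin (m + 1) → ℝ)
  · refine (enorm_integral_prod_le hYm hA.le ha hψ haA s).trans ?_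
    calc _ ≤ ENNReal.ofReal A ^ m * (K * ∏ j, ENNReal.ofReal (s j -
            (Fin.cons 0 s : Fin (m + 1) → ℝ) j.castSucc) ^ (-(α * d * (1 + p)))) := by
          gcongr
          exact hKle s hstrict hsT
      _ ≤ ENNReal.ofReal A ^ m * ((K + 1) * ∏ j, ‖s j -
            (Fin.cons t₀ s : Fin (m + 1) → ℝ) j.castSucc‖ₑ ^ (-(α * d * (1 + p)))) := by
          exact mul_le_mul' le_rfl (mul_le_mul' le_self_add (Finset.prod_le_prod' fun j _ => hcmp j))
      _ = _ := by ring
  · rw [Fin.strictMono_iff_lt_succ] at hstrict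
    push Not at hstrict
    obtain ⟨j, hj⟩ := hstrict
    simp only [Fin.cons_succ] at hj
    have htop : ∏ j, ‖s j - (Fin.cons t₀ s : Fin (m + 1) → ℝ) j.castSucc‖ₑ ^
        (-(α * d * (1 + p))) = ∞ := by
      rw [← top_le_iff]
      refine le_of_eq_of_le ?_ (Finset.prod_le_prod' fun j _ => hcmp j)
      symm
      have hj' : ENNReal.ofReal (s j - (Fin.cons 0 s : Fin (m + 1) → ℝ) j.castSucc) ^
          (-(α * d * (1 + p))) = ∞ := by
        rw [ENNReal.ofReal_of_nonpos (by linarith), ENNReal.zero_rpow_of_neg (by linarith)]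
      have hne : ∀ i, ENNReal.ofReal (s i - (Fin.cons 0 s : Fin (m + 1) → ℝ) i.castSucc) ^
          (-(α * d * (1 + p))) ≠ 0 := fun i => by
        rw [ENNReal.rpow_neg, ne_eq, ENNReal.inv_eq_zero]
        finiteness
      exact WithTop.prod_eq_top (Finset.mem_univ j) hj' fun i _ => hne i
    rw [htop, ENNReal.mul_top]
    · exact le_top
    · exact mul_ne_zero (by simp) (pow_ne_zero _ (by simpa using hA))

/-- Moments of occupation integrals over short time intervals. -/
lemma exists_lintegral_enorm_pow_le (hT : 0 < T) (hα : 0 < α) (hp : 0 < p) (hp1 : p ≤ 1)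
    (hd : 0 < d) (hκ : α * d * (1 + p) < 1) (hY : Measurable (Function.uncurry Y))
    (hA1 : CondA1 P Y T α θ) (hY0 : ∀ ω, Y 0 ω = 0) {m : ℕ} (hm : 0 < m) (hme : Even m) :
    ∃ K : ℝ≥0∞, K ≠ ∞ ∧ ∀ (A : ℝ) (ψ : Ed d → ℝ) (a : Ed d → ℂ), 0 < A → Integrable a →
      Measurable ψ →
      (∀ y, (ψ y : ℂ) = ∫ u, a u * Complex.exp (Complex.I * Complex.ofReal ⟪u, y⟫)) →
      (∀ u, ‖a u‖ ≤ A * ‖u‖ ^ (p / 2)) →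
      ∀ t₀ t₁ : ℝ, 0 ≤ t₀ → t₀ < t₁ → t₁ ≤ T →
      ∫⁻ ω, ‖∫ s in Ico t₀ t₁, ψ (Y s ω)‖ₑ ^ m ∂P ≤
        K * (ENNReal.ofReal A * ENNReal.ofReal (t₁ - t₀) ^ (1 - α * d * (1 + p))) ^ m := by
  have hYm : ∀ t, Measurable (Y t) := fun t => hY.of_uncurry_left
  obtain ⟨K, hK, hle⟩ :=
    exists_enorm_integral_prod_le_sum_perm hT hα hp hp1 hd hYm hA1 hY0 hm
  set κ := α * d * (1 + p) with hκdef
  refine ⟨K * (m.factorial * (2 * ENNReal.ofReal (1 - κ)⁻¹) ^ m), by finiteness,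
    fun A ψ a hA ha hψm hψ haA t₀ t₁ ht₀ ht ht₁ => ?_⟩
  set μ := (volume : Measure ℝ).restrict (Ico t₀ t₁) with hμ
  set ν := Measure.pi fun _ : Fin m => μ with hν
  have hbd : ∀ y, ‖ψ y‖ ≤ ∫ u, ‖a u‖ := fun y => by
    rw [← Complex.norm_real, hψ]
    refine (norm_integral_le_integral_norm _).trans_eq ?_
    refine integral_congr_ae (Eventually.of_forall fun u => ?_)
    simp only [norm_mul]
    rw [mul_comm Complex.I, Complex.norm_exp_ofReal_mul_I, mul_one]
  have hjoint : Measurable fun q : Ω × (Fin m → ℝ) => ∏ j, ψ (Y (q.2 j) q.1) :=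
    Finset.measurable_prod _ fun j _ => hψm.comp <|
      hY.comp (g := Function.uncurry Y) (f := fun q : Ω × (Fin m → ℝ) => (q.2 j, q.1))
        (by fun_prop)
  have hint : Integrable (fun q : Ω × (Fin m → ℝ) => ∏ j, ψ (Y (q.2 j) q.1)) (P.prod ν) := by
    refine Integrable.of_bound hjoint.aestronglyMeasurable ((∫ u, ‖a u‖) ^ m)
      (Eventually.of_forall fun q => ?_)
    rw [norm_prod]
    refine (Finset.prod_le_prod (fun _ _ => norm_nonneg _) fun j _ => hbd _).trans_eq ?_
    simp
  have hpow : ∀ ω, (∫ s, ψ (Y s ω) ∂μ) ^ m = ∫ t, ∏ j, ψ (Y (t j) ω) ∂ν := fun ω => by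
    rw [hν, integral_fintype_prod_eq_pow (fun s => ψ (Y s ω)), Fintype.card_fin]
  have hpowe : ∀ ω, ‖∫ s, ψ (Y s ω) ∂μ‖ₑ ^ m =
      ENNReal.ofReal (∫ t, ∏ j, ψ (Y (t j) ω) ∂ν) := fun ω => by
    rw [← hpow, ← Real.enorm_eq_ofReal (hme.pow_nonneg _), enorm_pow]
  simp_rw [hpowe]
  rw [← ofReal_integral_eq_lintegral_ofReal hint.integral_prod_left
    (Eventually.of_forall fun ω => (hme.pow_nonneg _).trans_eq (hpow ω)),
    integral_integral_swap hint]
  have hmem : ∀ᵐ t ∂ν, ∀ j, t j ∈ Ico t₀ t₁ := by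
    rw [ae_all_iff]
    intro j
    exact (Measure.quasiMeasurePreserving_eval (fun _ : Fin m => μ) j).ae
      (ae_restrict_mem measurableSet_Ico)
  have hperm : ∀ σ : Equiv.Perm (Fin m), MeasurePreserving (fun t : Fin m → ℝ => t ∘ σ) ν ν :=
    fun σ => by
      convert measurePreserving_piCongrLeft (fun _ : Fin m => μ) σ.symm using 1
      ext t j
      obtain ⟨i, rfl⟩ := σ.symm.surjective j
      rw [MeasurableEquiv.coe_piCongrLeft, Equiv.piCongrLeft_apply_apply]
      simp
  have hmeas : Measurable fun t : Fin m → ℝ =>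
      ∏ j, ‖t j - (Fin.cons t₀ t : Fin (m + 1) → ℝ) j.castSucc‖ₑ ^ (-κ) := by
    refine Finset.measurable_prod _ fun j _ => ((Measurable.sub (by fun_prop) ?_).enorm).pow_const _
    obtain ⟨n, rfl⟩ := Nat.exists_eq_succ_of_ne_zero hm.ne'
    refine Fin.cases ?_ (fun j => ?_) j
    · simp
    · simp only [← Fin.succ_castSucc, Fin.cons_succ]
      fun_prop
  calc _ ≤ ‖∫ t, ∫ ω, ∏ j, ψ (Y (t j) ω) ∂P ∂ν‖ₑ := Real.ofReal_le_enorm _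
    _ ≤ ∫⁻ t, ‖∫ ω, ∏ j, ψ (Y (t j) ω) ∂P‖ₑ ∂ν := enorm_integral_le_lintegral_enorm _
    _ ≤ ∫⁻ t, K * ENNReal.ofReal A ^ m * ∑ σ : Equiv.Perm (Fin m),
        ∏ j, ‖(t ∘ σ) j - (Fin.cons t₀ (t ∘ σ) : Fin (m + 1) → ℝ) j.castSucc‖ₑ ^ (-κ) ∂ν := by
        refine lintegral_mono_ae ?_
        filter_upwards [hmem] with t ht
        exact hle A ψ a hA ha hψ haA t₀ t ht₀ (fun j => (ht j).1) fun j => (ht j).2.trans_le ht₁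
    _ = K * ENNReal.ofReal A ^ m * ∑ σ : Equiv.Perm (Fin m),
        ∫⁻ t, ∏ j, ‖t j - (Fin.cons t₀ t : Fin (m + 1) → ℝ) j.castSucc‖ₑ ^ (-κ) ∂ν := by
        rw [lintegral_const_mul' _ _ (by finiteness), lintegral_finsetSum]
        · congr 1
          exact Finset.sum_congr rfl fun σ _ => (hperm σ).lintegral_comp hmeas
        · exact fun σ _ => hmeas.comp (hperm σ).measurable
    _ ≤ K * ENNReal.ofReal A ^ m * ∑ _σ : Equiv.Perm (Fin m),
        (2 * ENNReal.ofReal (1 - κ)⁻¹ * ENNReal.ofReal (t₁ - t₀) ^ (1 - κ)) ^ m := by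
        gcongr
        exact lintegral_prod_enorm_sub_rpow_le hκ ht m
    _ = _ := by
        simp only [Finset.sum_const, Finset.card_univ, Fintype.card_perm, Fintype.card_fin,
          nsmul_eq_mul, mul_pow]
        ring

end Moments

section GaussianKernel

variable {d : ℕ}

/-- The unnormalized Gaussian kernel of width `ε`, with total mass `(2π)^d`. -/
def gaussKernel (ε : ℝ) (w : Ed d) : ℝ :=
  (2 * Real.pi / ε ^ 2) ^ ((d : ℝ) / 2) * Real.exp (-(‖w‖ ^ 2 / (2 * ε ^ 2)))

/-- The Fourier symbol of the Gaussian kernel of width `ε` centred at `x`. -/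
def gaussSymbol (ε : ℝ) (x u : Ed d) : ℂ :=
  Complex.exp (-((ε ^ 2 / 2 * ‖u‖ ^ 2 : ℝ) : ℂ)) * Complex.exp (-(⟪u, x⟫ : ℝ) * Complex.I)

lemma gaussKernel_nonneg (ε : ℝ) (w : Ed d) : 0 ≤ gaussKernel ε w := by
  unfold gaussKernel
  positivity

lemma continuous_gaussKernel (ε : ℝ) : Continuous (gaussKernel (d := d) ε) := by
  unfold gaussKernel
  fun_prop

lemma gaussKernel_le (ε : ℝ) (w : Ed d) :
    gaussKernel ε w ≤ (2 * Real.pi / ε ^ 2) ^ ((d : ℝ) / 2) := by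
  unfold gaussKernel
  refine mul_le_of_le_one_right (by positivity) (Real.exp_le_one_iff.mpr ?_)
  have : 0 ≤ ‖w‖ ^ 2 / (2 * ε ^ 2) := by positivity
  linarith

lemma gaussSymbol_mul_exp (ε : ℝ) (x y u : Ed d) :
    gaussSymbol ε x u * Complex.exp (Complex.I * Complex.ofReal ⟪u, y⟫) =
      Complex.exp (-((ε ^ 2 / 2 : ℝ) : ℂ) * ‖u‖ ^ 2 + Complex.I * (⟪y - x, u⟫ : ℝ)) := by
  unfold gaussSymbol
  rw [← Complex.exp_add, ← Complex.exp_add]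
  congr 1
  rw [inner_sub_left, real_inner_comm u y, real_inner_comm u x]
  push_cast
  ring

lemma integrable_gaussSymbol {ε : ℝ} (hε : 0 < ε) (x : Ed d) :
    Integrable (gaussSymbol ε x) := by
  have hb : 0 < (((ε ^ 2 / 2 : ℝ) : ℂ)).re := by rw [Complex.ofReal_re]; positivity
  refine (GaussianFourier.integrable_cexp_neg_mul_sq_norm_add hb Complex.I (0 - x)).congr
    (Eventually.of_forall fun u => ?_)
  dsimp only
  rw [← gaussSymbol_mul_exp]
  simp

lemma gaussKernel_eq_integral {ε : ℝ} (hε : 0 < ε) (x y : Ed d) :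
    (gaussKernel ε (y - x) : ℂ) =
      ∫ u, gaussSymbol ε x u * Complex.exp (Complex.I * Complex.ofReal ⟪u, y⟫) := by
  have hb : 0 < (((ε ^ 2 / 2 : ℝ) : ℂ)).re := by rw [Complex.ofReal_re]; positivity
  simp_rw [gaussSymbol_mul_exp]
  rw [GaussianFourier.integral_cexp_neg_mul_sq_norm_add hb Complex.I (y - x)]
  unfold gaussKernel
  rw [finrank_euclideanSpace_fin, Complex.ofReal_mul, Complex.ofReal_exp,
    Complex.ofReal_cpow (by positivity)]
  have hε' : (ε : ℂ) ≠ 0 := by exact_mod_cast hε.ne'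
  congr 2
  · push_cast
    field_simp
  · push_cast
    rfl
  · rw [Complex.I_sq]
    push_cast
    field_simp
    norm_num

lemma norm_exp_ofReal_mul_I_sub_le (s t : ℝ) :
    ‖Complex.exp (s * Complex.I) - Complex.exp (t * Complex.I)‖ ≤ |s - t| := by
  have h : Complex.exp (s * Complex.I) - Complex.exp (t * Complex.I) =
      Complex.exp (t * Complex.I) * (Complex.exp (Complex.I * (s - t : ℝ)) - 1) := by
    rw [mul_sub, ← Complex.exp_add]
    push_cast
    ring_nf
  rw [h, norm_mul, Complex.norm_exp_ofReal_mul_I, one_mul]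
  exact Real.norm_exp_I_mul_ofReal_sub_one_le

/-- Hölder-type bound on the difference of the symbols at two successive dyadic scales. -/
lemma norm_gaussSymbol_sub_le {ε D p : ℝ} (hε : 0 < ε) (hD : 0 ≤ D) (hp : 0 < p) (hp1 : p ≤ 1)
    {x x' : Ed d} (hx : ‖x - x'‖ ≤ D * ε) (u : Ed d) :
    ‖gaussSymbol ε x u - gaussSymbol (2 * ε) x' u‖ ≤
      (4 + D) * ε ^ (p / 2) * ‖u‖ ^ (p / 2) := by
  set z := ε * ‖u‖ with hz
  have hz0 : 0 ≤ z := by positivity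
  rw [mul_assoc, ← Real.mul_rpow hε.le (norm_nonneg u), ← hz]
  set e₁ := Complex.exp (-(⟪u, x⟫ : ℝ) * Complex.I) with he₁
  set e₂ := Complex.exp (-(⟪u, x'⟫ : ℝ) * Complex.I) with he₂
  have hn₁ : ‖e₁‖ = 1 := by
    rw [he₁, ← Complex.ofReal_neg, Complex.norm_exp_ofReal_mul_I]
  have hn₂ : ‖e₂‖ = 1 := by
    rw [he₂, ← Complex.ofReal_neg, Complex.norm_exp_ofReal_mul_I]
  have h12 : ‖e₁ - e₂‖ ≤ D * z := by
    rw [he₁, he₂, ← Complex.ofReal_neg, ← Complex.ofReal_neg]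
    refine (norm_exp_ofReal_mul_I_sub_le _ _).trans ?_
    have : -(⟪u, x⟫ : ℝ) - -⟪u, x'⟫ = -⟪u, x - x'⟫ := by rw [inner_sub_right]; ring
    rw [this, abs_neg]
    calc |⟪u, x - x'⟫| ≤ ‖u‖ * ‖x - x'‖ := abs_real_inner_le_norm _ _
      _ ≤ ‖u‖ * (D * ε) := by gcongr
      _ = D * z := by rw [hz]; ring
  set g₁ := Real.exp (-(z ^ 2 / 2)) with hg₁
  set g₂ := Real.exp (-(2 * z ^ 2)) with hg₂
  have h₁ : gaussSymbol ε x u = g₁ * e₁ := by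
    rw [gaussSymbol, hg₁, ← he₁, Complex.ofReal_exp, hz]
    congr 2
    push_cast
    ring
  have h₂ : gaussSymbol (2 * ε) x' u = g₂ * e₂ := by
    rw [gaussSymbol, hg₂, ← he₂, Complex.ofReal_exp, hz]
    congr 2
    push_cast
    ring
  have hg₁1 : g₁ ≤ 1 := Real.exp_le_one_iff.mpr (by nlinarith [sq_nonneg z])
  have hg₂0 : 0 ≤ g₂ := (Real.exp_pos _).le
  have hg₁0 : 0 ≤ g₁ := (Real.exp_pos _).le
  have hg21 : g₂ ≤ g₁ := Real.exp_le_exp.mpr (by nlinarith [sq_nonneg z])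
  have hg₂z : 1 - 2 * z ^ 2 ≤ g₂ := by
    have := Real.add_one_le_exp (-(2 * z ^ 2))
    linarith
  have hle : ‖gaussSymbol ε x u - gaussSymbol (2 * ε) x' u‖ ≤ ‖e₁ - e₂‖ + (g₁ - g₂) := by
    have : gaussSymbol ε x u - gaussSymbol (2 * ε) x' u =
        g₁ * (e₁ - e₂) + ((g₁ - g₂ : ℝ) : ℂ) * e₂ := by
      rw [h₁, h₂]; push_cast; ring
    rw [this]
    refine (norm_add_le _ _).trans ?_
    rw [norm_mul, norm_mul, hn₂, mul_one, Complex.norm_real, Complex.norm_real,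
      Real.norm_of_nonneg hg₁0, Real.norm_of_nonneg (sub_nonneg.mpr hg21)]
    gcongr
    exact mul_le_of_le_one_left (norm_nonneg _) hg₁1
  refine hle.trans ?_
  rcases le_total z 1 with h | h
  · have hzp : z ≤ z ^ (p / 2) := by
      rcases hz0.eq_or_lt with h0 | h0
      · rw [← h0]; positivity
      · conv_lhs => rw [← Real.rpow_one z]
        exact Real.rpow_le_rpow_of_exponent_ge h0 h (by linarith)
    calc ‖e₁ - e₂‖ + (g₁ - g₂) ≤ D * z + 2 * z ^ 2 := by linarith
      _ ≤ (4 + D) * z := by nlinarith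
      _ ≤ _ := by gcongr
  · have hzp : 1 ≤ z ^ (p / 2) := Real.one_le_rpow h (by positivity)
    have : ‖e₁ - e₂‖ ≤ 2 := (norm_sub_le _ _).trans (by rw [hn₁, hn₂]; norm_num)
    calc ‖e₁ - e₂‖ + (g₁ - g₂) ≤ 4 + D := by linarith
      _ ≤ _ := le_mul_of_one_le_right (by positivity) hzp

/-- The Gaussian kernel dominates normalized indicators of balls. -/
lemma exists_one_le_mul_gaussKernel (d : ℕ) (D : ℝ) : ∃ c : ℝ, 0 < c ∧
    ∀ ε : ℝ, 0 < ε → ∀ x w : Ed d, ‖w‖ ≤ D * ε →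
      1 ≤ c * volume.real (Metric.closedBall x ε) * gaussKernel ε w := by
  have hv : 0 < volume.real (Metric.ball (0 : Ed d) 1) :=
    ENNReal.toReal_pos (Metric.measure_ball_pos _ _ one_pos).ne' measure_ball_lt_top.ne
  set v := volume.real (Metric.ball (0 : Ed d) 1) with hvdef
  have hpi := Real.pi_pos
  refine ⟨Real.exp (D ^ 2 / 2) / ((2 * Real.pi) ^ ((d : ℝ) / 2) * v), by positivity,
    fun ε hε x w hw => ?_⟩
  rw [Measure.addHaar_real_closedBall _ _ hε.le, finrank_euclideanSpace_fin, ← hvdef, gaussKernel,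
    Real.div_rpow (by positivity) (by positivity), ← Real.rpow_natCast ε 2, ← Real.rpow_mul hε.le]
  simp only [Nat.cast_ofNat, Real.rpow_ofNat]
  have hdd : (2 : ℝ) * ((d : ℝ) / 2) = d := by ring
  rw [hdd, Real.rpow_natCast]
  have hexp : Real.exp (-(D ^ 2 / 2)) ≤ Real.exp (-(‖w‖ ^ 2 / (2 * ε ^ 2))) := by
    refine Real.exp_le_exp.mpr (neg_le_neg ?_)
    rw [div_le_div_iff₀ (by positivity) (by positivity)]
    have := pow_le_pow_left₀ (norm_nonneg w) hw 2
    nlinarith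
  calc (1 : ℝ) = Real.exp (D ^ 2 / 2) * Real.exp (-(D ^ 2 / 2)) := by
        rw [← Real.exp_add]; simp
    _ ≤ Real.exp (D ^ 2 / 2) * Real.exp (-(‖w‖ ^ 2 / (2 * ε ^ 2))) := by gcongr
    _ = _ := by field_simp

end GaussianKernel

section Grid

variable {d : ℕ}

lemma norm_le_of_forall_abs_le {x : Ed d} {c : ℝ} (hc : 0 ≤ c) (hx : ∀ l, |x l| ≤ c) :
    ‖x‖ ≤ d * c := by
  rw [EuclideanSpace.norm_eq]
  refine Real.sqrt_le_iff.mpr ⟨by positivity, ?_⟩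
  calc ∑ l, ‖x l‖ ^ 2 ≤ ∑ _l : Fin d, c ^ 2 := by
        refine Finset.sum_le_sum fun l _ => ?_
        exact pow_le_pow_left₀ (norm_nonneg _) (hx l) 2
    _ = (d : ℝ) * c ^ 2 := by simp
    _ ≤ (d * d) * c ^ 2 := by
        gcongr
        exact_mod_cast Nat.le_mul_self d
    _ = (d * c) ^ 2 := by ring

/-- The point of the dyadic grid of mesh `2⁻ᵏ` with integer coordinates `n`. -/
def gridPt (k : ℕ) (n : Fin d → ℤ) : Ed d := WithLp.toLp 2 fun l => (n l : ℝ) * (1 / 2) ^ k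

/-- The integer coordinates of the grid point one scale up. -/
def gridParent (n : Fin d → ℤ) : Fin d → ℤ := fun l => n l / 2

/-- The indices of the grid points of mesh `2⁻ᵏ` in the cube `[-R, R]^d`. -/
def gridBox (d R k : ℕ) : Finset (Fin d → ℤ) :=
  Fintype.piFinset fun _ => Finset.Icc (-(R * 2 ^ k : ℤ)) (R * 2 ^ k)

lemma mem_gridBox {R k : ℕ} {n : Fin d → ℤ} :
    n ∈ gridBox d R k ↔ ∀ l, -(R * 2 ^ k : ℤ) ≤ n l ∧ n l ≤ R * 2 ^ k := by
  simp [gridBox]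

lemma card_gridBox_le (d R k : ℕ) : (gridBox d R k).card ≤ ((2 * R + 1) * 2 ^ k) ^ d := by
  rw [gridBox, Fintype.card_piFinset]
  simp only [Int.card_Icc, Finset.prod_const, Finset.card_univ, Fintype.card_fin]
  refine Nat.pow_le_pow_left ?_ d
  have h1 : 1 ≤ 2 ^ k := Nat.one_le_two_pow
  have : ((R * 2 ^ k : ℤ) + 1 - -(R * 2 ^ k)).toNat = 2 * (R * 2 ^ k) + 1 := by
    have h2 : (R * 2 ^ k : ℤ) = ((R * 2 ^ k : ℕ) : ℤ) := by push_cast; rfl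
    rw [h2]
    omega
  rw [this]
  nlinarith

lemma gridParent_mem {R k : ℕ} {n : Fin d → ℤ} (hn : n ∈ gridBox d R (k + 1)) :
    gridParent n ∈ gridBox d R k := by
  rw [mem_gridBox] at hn ⊢
  intro l
  have := hn l
  rw [pow_succ, ← mul_assoc] at this
  simp only [gridParent]
  omega

lemma norm_gridPt_sub_parent_le (k : ℕ) (n : Fin d → ℤ) :
    ‖gridPt (k + 1) n - gridPt k (gridParent n)‖ ≤ d * (1 / 2) ^ (k + 1) := by
  refine norm_le_of_forall_abs_le (by positivity) fun l => ?_
  have h : (gridPt (k + 1) n - gridPt k (gridParent n)) l =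
      ((n l - 2 * (n l / 2) : ℤ) : ℝ) * (1 / 2) ^ (k + 1) := by
    simp only [gridPt, gridParent, PiLp.sub_apply]
    push_cast
    ring
  have h2 : |((n l - 2 * (n l / 2) : ℤ) : ℝ)| ≤ 1 := by
    have : |n l - 2 * (n l / 2)| ≤ 1 := by rw [abs_le]; omega
    exact_mod_cast this
  rw [h, abs_mul, abs_of_nonneg (by positivity : (0 : ℝ) ≤ (1 / 2) ^ (k + 1))]
  exact mul_le_of_le_one_left (by positivity) h2

/-- Every point of the cube `[-R, R]^d` is close to a grid point. -/
lemma exists_gridPt_near {R : ℕ} {x : Ed d} (hx : ∀ l, |x l| ≤ R) (k : ℕ) :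
    ∃ n ∈ gridBox d R k, ‖x - gridPt k n‖ ≤ d * (1 / 2) ^ k := by
  have h2 : (0 : ℝ) < 2 ^ k := by positivity
  refine ⟨fun l => ⌊x l * 2 ^ k⌋, mem_gridBox.mpr fun l => ?_,
    norm_le_of_forall_abs_le (by positivity) fun l => ?_⟩
  · have := abs_le.mp (hx l)
    constructor
    · rw [Int.le_floor]
      push_cast
      nlinarith
    · have h3 : (⌊x l * 2 ^ k⌋ : ℝ) ≤ R * 2 ^ k := (Int.floor_le _).trans (by nlinarith)
      exact_mod_cast h3
  · have h : (x - gridPt k fun l => ⌊x l * 2 ^ k⌋) l = Int.fract (x l * 2 ^ k) * (1 / 2) ^ k := by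
      have h12 : (1 / 2 : ℝ) ^ k * 2 ^ k = 1 := by rw [← mul_pow]; norm_num
      simp only [gridPt, PiLp.sub_apply, Int.fract]
      linear_combination (-(x l)) * h12
    rw [h, abs_mul, abs_of_nonneg (Int.fract_nonneg _),
      abs_of_nonneg (by positivity : (0 : ℝ) ≤ (1 / 2) ^ k)]
    exact mul_le_of_le_one_left (by positivity) (Int.fract_lt_one _).le

/-- Overlapping dyadic subintervals of `[0, T]` of length at most `2T / 2^q`. -/
def dyadicIco (T : ℝ) (q j : ℕ) : Set ℝ :=
  Ico (T * (j * (1 / 2) ^ q)) (min (T * ((j + 2) * (1 / 2) ^ q)) T)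

/-- Every short interval is contained in a dyadic interval of comparable length. -/
lemma exists_Ico_subset_dyadicIco {T s t : ℝ} (hT : 0 < T) (hs : 0 ≤ s) (hst : s < t)
    (ht : t ≤ T) : ∃ q j : ℕ, j < 2 ^ q ∧ Ico s t ⊆ dyadicIco T q j ∧
      (1 / 2 : ℝ) ^ q ≤ 2 / T * (t - s) := by
  obtain ⟨q, hq1, hq2⟩ := exists_nat_pow_near_of_lt_one (x := (t - s) / T) (y := 1 / 2)
    (div_pos (by linarith) hT) ((div_le_one hT).mpr (by linarith)) (by norm_num) (by norm_num)
  have h2 : (0 : ℝ) < 2 ^ q := by positivity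
  have h12 : (1 / 2 : ℝ) ^ q * 2 ^ q = 1 := by rw [← mul_pow]; norm_num
  rw [div_le_iff₀ hT] at hq2
  rw [lt_div_iff₀ hT, pow_succ] at hq1
  have hj0 : 0 ≤ s / T * 2 ^ q := by positivity
  have hj1 := Nat.floor_le hj0
  have hj2 := Nat.lt_floor_add_one (s / T * 2 ^ q)
  set j := ⌊s / T * 2 ^ q⌋₊ with hj
  have hsj : s = T * (s / T * 2 ^ q * (1 / 2) ^ q) := by
    rw [mul_assoc (s / T), mul_comm (2 ^ q), h12]; field_simp
  refine ⟨q, j, ?_, ?_, ?_⟩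
  · have : (j : ℝ) < 2 ^ q := by
      refine hj1.trans_lt ?_
      have : s / T < 1 := (div_lt_one hT).mpr (by linarith)
      nlinarith
    exact_mod_cast this
  · refine Ico_subset_Ico ?_ (le_min ?_ ht)
    · rw [hsj]
      gcongr
    · have : s ≤ T * ((j + 1) * (1 / 2) ^ q) := by
        rw [hsj]
        gcongr
      nlinarith
  · rw [div_mul_eq_mul_div, le_div_iff₀ hT]
    linarith

lemma dyadicIco_start_lt {T : ℝ} (hT : 0 < T) {q j : ℕ} (hj : j < 2 ^ q) :
    T * (j * (1 / 2) ^ q) < min (T * ((j + 2) * (1 / 2) ^ q)) T := by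
  have h2 : (0 : ℝ) < (1 / 2) ^ q := by positivity
  have h12 : (2 : ℝ) ^ q * (1 / 2) ^ q = 1 := by rw [← mul_pow]; norm_num
  have hj' : (j : ℝ) < 2 ^ q := by exact_mod_cast hj
  refine lt_min ?_ ?_
  · gcongr
    linarith
  · refine mul_lt_of_lt_one_right hT (lt_of_lt_of_eq ?_ h12)
    gcongr

end Grid

section Chaining

variable {d : ℕ}

/-- The occupation of the path `y` over `I`, smoothed at scale `2⁻ᵏ` around a grid point. -/
def smoothedOcc (y : ℝ → Ed d) (k : ℕ) (n : Fin d → ℤ) (I : Set ℝ) : ℝ :=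
  ∫ s in I, gaussKernel ((1 / 2) ^ k) (y s - gridPt k n)

/-- A weighted power of a chaining increment. -/
def chainTerm (y : ℝ → Ed d) (T β : ℝ) (m k q : ℕ) (n : Fin d → ℤ) (j : ℕ) : ℝ≥0∞ :=
  (ENNReal.ofReal (((1 / 2) ^ q) ^ (-β)) *
    ‖smoothedOcc y (k + 1) n (dyadicIco T q j) -
      smoothedOcc y k (gridParent n) (dyadicIco T q j)‖ₑ) ^ m * 2 ^ k

/-- The sum of all weighted chaining increments over the cube `[-R, R]^d`. -/
def chainSum (y : ℝ → Ed d) (T β : ℝ) (m R : ℕ) : ℝ≥0∞ :=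
  ∑' k, ∑' q, ∑ n ∈ gridBox d R (k + 1), ∑ j ∈ Finset.range (2 ^ q), chainTerm y T β m k q n j

lemma chainTerm_le_chainSum (y : ℝ → Ed d) (T β : ℝ) (m : ℕ) {R k q : ℕ} {n : Fin d → ℤ} {j : ℕ}
    (hn : n ∈ gridBox d R (k + 1)) (hj : j < 2 ^ q) :
    chainTerm y T β m k q n j ≤ chainSum y T β m R := by
  refine le_trans ?_ (ENNReal.le_tsum k)
  refine le_trans ?_ (ENNReal.le_tsum q)
  refine le_trans ?_ (Finset.single_le_sum (fun _ _ => zero_le) hn)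
  exact Finset.single_le_sum (f := fun j => chainTerm y T β m k q n j) (fun _ _ => zero_le)
    (Finset.mem_range.mpr hj)

lemma integrableOn_gaussKernel {y : ℝ → Ed d} (hy : Measurable y) (ε : ℝ) (x : Ed d) (T : ℝ)
    (q j : ℕ) : IntegrableOn (fun s => gaussKernel ε (y s - x)) (dyadicIco T q j) := by
  unfold dyadicIco
  refine Integrable.of_bound
    ((continuous_gaussKernel ε).measurable.comp (hy.sub_const x)).aestronglyMeasurable
    ((2 * Real.pi / ε ^ 2) ^ ((d : ℝ) / 2)) (Eventually.of_forall fun s => ?_)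
  rw [Real.norm_of_nonneg (gaussKernel_nonneg _ _)]
  exact gaussKernel_le _ _

lemma dyadicIco_length_le (T : ℝ) (q j : ℕ) :
    min (T * ((j + 2) * (1 / 2) ^ q)) T - T * (j * (1 / 2) ^ q) ≤ 2 * T * (1 / 2) ^ q := by
  have := min_le_left (T * ((j + 2) * (1 / 2) ^ q)) T
  linarith

lemma smoothedOcc_zero_le {y : ℝ → Ed d} (hy : Measurable y) {T : ℝ} (hT : 0 < T)
    (n : Fin d → ℤ) {q j : ℕ} (hj : j < 2 ^ q) :
    smoothedOcc y 0 n (dyadicIco T q j) ≤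
      (2 * Real.pi) ^ ((d : ℝ) / 2) * (2 * T) * (1 / 2) ^ q := by
  have hlt := dyadicIco_start_lt hT hj
  calc smoothedOcc y 0 n (dyadicIco T q j)
      ≤ ∫ _s in dyadicIco T q j, (2 * Real.pi) ^ ((d : ℝ) / 2) := by
        refine setIntegral_mono (integrableOn_gaussKernel hy _ _ T q j) ?_ fun s => ?_
        · exact integrableOn_const (by simp [dyadicIco])
        · simpa using gaussKernel_le 1 (y s - gridPt 0 n)
    _ ≤ _ := by
        rw [setIntegral_const, dyadicIco, Real.volume_real_Ico_of_le hlt.le, smul_eq_mul, mul_comm,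
          mul_assoc]
        gcongr
        exact dyadicIco_length_le T q j

/-- Uniform bound on the smoothed occupations obtained by chaining. -/
lemma smoothedOcc_le_of_chainSum {y : ℝ → Ed d} (hy : Measurable y) {T β : ℝ} (hT : 0 < T)
    (hβ1 : β ≤ 1) {m R : ℕ} (hm : 0 < m) {k : ℕ} {n : Fin d → ℤ} (hn : n ∈ gridBox d R k)
    {q j : ℕ} (hj : j < 2 ^ q) :
    ENNReal.ofReal (smoothedOcc y k n (dyadicIco T q j)) ≤
      (ENNReal.ofReal ((2 * Real.pi) ^ ((d : ℝ) / 2) * (2 * T)) +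
        chainSum y T β m R ^ ((m : ℝ)⁻¹) * (1 - (2⁻¹ : ℝ≥0∞) ^ ((m : ℝ)⁻¹))⁻¹) *
      ENNReal.ofReal (((1 / 2) ^ q) ^ β) := by
  set W := chainSum y T β m R ^ ((m : ℝ)⁻¹) with hW
  set r := (2⁻¹ : ℝ≥0∞) ^ ((m : ℝ)⁻¹) with hr
  set C₀ := ENNReal.ofReal ((2 * Real.pi) ^ ((d : ℝ) / 2) * (2 * T)) with hC₀
  set w := ENNReal.ofReal (((1 / 2) ^ q) ^ β) with hw
  have hq0 : (0 : ℝ) < (1 / 2) ^ q := by positivity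
  have hq1 : (1 / 2 : ℝ) ^ q ≤ 1 := pow_le_one₀ (by norm_num) (by norm_num)
  have hww : w * ENNReal.ofReal (((1 / 2) ^ q) ^ (-β)) = 1 := by
    rw [hw, ← ENNReal.ofReal_mul (by positivity), ← Real.rpow_add hq0]
    simp
  have key : ENNReal.ofReal (smoothedOcc y k n (dyadicIco T q j)) ≤
      (C₀ + W * ∑ i ∈ Finset.range k, r ^ i) * w := by
    induction k generalizing n with
    | zero =>
      simp only [Finset.range_zero, Finset.sum_empty, mul_zero, add_zero]
      rw [hC₀, hw, ← ENNReal.ofReal_mul (by positivity)]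
      refine ENNReal.ofReal_le_ofReal ((smoothedOcc_zero_le hy hT n hj).trans ?_)
      gcongr
      conv_lhs => rw [← Real.rpow_one ((1 / 2 : ℝ) ^ q)]
      exact Real.rpow_le_rpow_of_exponent_ge hq0 hq1 hβ1
    | succ k ih =>
      have hinc : ‖smoothedOcc y (k + 1) n (dyadicIco T q j) -
          smoothedOcc y k (gridParent n) (dyadicIco T q j)‖ₑ ≤ W * r ^ k * w := by
        have h := chainTerm_le_chainSum y T β m hn hj
        rw [chainTerm] at h
        set x := ENNReal.ofReal (((1 / 2) ^ q) ^ (-β)) * ‖smoothedOcc y (k + 1) n (dyadicIco T q j) -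
          smoothedOcc y k (gridParent n) (dyadicIco T q j)‖ₑ with hx
        have h2 : (2 : ℝ≥0∞) ^ k * 2⁻¹ ^ k = 1 := by
          rw [← mul_pow, ENNReal.mul_inv_cancel (by simp) (by simp), one_pow]
        have h' : x ^ m ≤ chainSum y T β m R * 2⁻¹ ^ k := by
          calc x ^ m = x ^ m * 2 ^ k * 2⁻¹ ^ k := by rw [mul_assoc, h2, mul_one]
            _ ≤ _ := by gcongr
        have hxle : x ≤ W * r ^ k := by
          calc x = (x ^ m) ^ ((m : ℝ)⁻¹) := (ENNReal.pow_rpow_inv_natCast hm.ne' x).symm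
            _ ≤ (chainSum y T β m R * 2⁻¹ ^ k) ^ ((m : ℝ)⁻¹) := by gcongr
            _ = W * r ^ k := by
              rw [ENNReal.mul_rpow_of_nonneg _ _ (by positivity), hW, hr, ← ENNReal.rpow_natCast,
                ← ENNReal.rpow_natCast, ← ENNReal.rpow_mul, ← ENNReal.rpow_mul, mul_comm (k : ℝ)]
        calc _ = w * x := by rw [hx, ← mul_assoc, hww, one_mul]
          _ ≤ w * (W * r ^ k) := by gcongr
          _ = _ := mul_comm _ _
      have hsplit : ENNReal.ofReal (smoothedOcc y (k + 1) n (dyadicIco T q j)) ≤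
          ‖smoothedOcc y (k + 1) n (dyadicIco T q j) -
            smoothedOcc y k (gridParent n) (dyadicIco T q j)‖ₑ +
          ENNReal.ofReal (smoothedOcc y k (gridParent n) (dyadicIco T q j)) := by
        refine le_trans ?_ (add_le_add_left (Real.ofReal_le_enorm _) _)
        refine le_trans (le_of_eq ?_) ENNReal.ofReal_add_le
        rw [sub_add_cancel]
      calc _ ≤ W * r ^ k * w + (C₀ + W * ∑ i ∈ Finset.range k, r ^ i) * w :=
            hsplit.trans (add_le_add hinc (ih (gridParent_mem hn)))
        _ = _ := by rw [Finset.sum_range_succ]; ring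
  refine key.trans ?_
  gcongr
  rw [← ENNReal.tsum_geometric]
  exact ENNReal.sum_le_tsum _

/-- Finiteness of the chaining sums gives a Hölder bound for the occupation of small balls. -/
lemma exists_volume_Icc_inter_preimage_le {y : ℝ → Ed d} (hy : Measurable y) {T β : ℝ}
    (hT : 0 < T) (hβ : 0 < β) (hβ1 : β ≤ 1) {m R : ℕ} (hm : 0 < m)
    (hfin : chainSum y T β m R ≠ ∞) :
    ∃ K : ℝ, 0 ≤ K ∧ ∀ (k : ℕ) (x : Ed d), (∀ l, |x l| ≤ R) → ∀ s t : ℝ, 0 ≤ s → s ≤ t → t ≤ T →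
      volume (Icc s t ∩ y ⁻¹' Metric.closedBall x ((1 / 2) ^ k)) ≤
        ENNReal.ofReal (K * (t - s) ^ β) * volume (Metric.closedBall x ((1 / 2) ^ k)) := by
  obtain ⟨c, hc, hcle⟩ := exists_one_le_mul_gaussKernel d (d + 1)
  set C := ENNReal.ofReal ((2 * Real.pi) ^ ((d : ℝ) / 2) * (2 * T)) +
        chainSum y T β m R ^ ((m : ℝ)⁻¹) * (1 - (2⁻¹ : ℝ≥0∞) ^ ((m : ℝ)⁻¹))⁻¹ with hC
  have hCfin : C ≠ ∞ := by
    have hm' : (0 : ℝ) < (m : ℝ)⁻¹ := by positivity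
    have hr : (2⁻¹ : ℝ≥0∞) ^ ((m : ℝ)⁻¹) < 1 :=
      ENNReal.rpow_lt_one (by simp) hm'
    have : (1 - (2⁻¹ : ℝ≥0∞) ^ ((m : ℝ)⁻¹)) ≠ 0 := (tsub_pos_of_lt hr).ne'
    finiteness
  refine ⟨c * C.toReal * (2 / T) ^ β, by positivity, fun k x hx s t hs hst ht => ?_⟩
  rcases hst.eq_or_lt with rfl | hst
  · refine le_trans (measure_mono inter_subset_left) ?_
    simp
  obtain ⟨q, j, hj, hsub, hq⟩ := exists_Ico_subset_dyadicIco hT hs hst ht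
  obtain ⟨n, hn, hxn⟩ := exists_gridPt_near hx k
  set ε : ℝ := (1 / 2) ^ k with hε
  have hε0 : 0 < ε := by positivity
  set v := volume.real (Metric.closedBall x ε) with hv
  have hvol : volume (Metric.closedBall x ε) = ENNReal.ofReal v :=
    (ofReal_measureReal measure_closedBall_lt_top.ne).symm
  set S := y ⁻¹' Metric.closedBall x ε with hS
  have hSm : MeasurableSet S := hy Metric.isClosed_closedBall.measurableSet
  have hone : ∀ s ∈ S, 1 ≤ c * v * gaussKernel ε (y s - gridPt k n) := by
    intro s hs
    refine hcle ε hε0 x _ ?_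
    have h1 : ‖y s - x‖ ≤ ε := by simpa [S, dist_eq_norm] using hs
    calc ‖y s - gridPt k n‖ = ‖(y s - x) + (x - gridPt k n)‖ := by abel_nf
      _ ≤ ‖y s - x‖ + ‖x - gridPt k n‖ := norm_add_le _ _
      _ ≤ _ := by linarith
  calc volume (Icc s t ∩ S) = volume (Ico s t ∩ S) :=
        measure_congr (Ico_ae_eq_Icc.symm.inter (ae_eq_refl S))
    _ ≤ volume (S ∩ dyadicIco T q j) := measure_mono fun u hu => ⟨hu.2, hsub hu.1⟩
    _ = ∫⁻ _u in S ∩ dyadicIco T q j, 1 := by simp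
    _ ≤ ∫⁻ u in S ∩ dyadicIco T q j, ENNReal.ofReal (c * v * gaussKernel ε (y u - gridPt k n)) := by
        refine setLIntegral_mono' (hSm.inter measurableSet_Ico) fun u hu => ?_
        exact ENNReal.one_le_ofReal.mpr (hone u hu.1)
    _ ≤ ∫⁻ u in dyadicIco T q j, ENNReal.ofReal (c * v * gaussKernel ε (y u - gridPt k n)) :=
        lintegral_mono_set inter_subset_right
    _ = ENNReal.ofReal (c * v) * ENNReal.ofReal (smoothedOcc y k n (dyadicIco T q j)) := by
        rw [smoothedOcc, ← ofReal_integral_eq_lintegral_ofReal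
          ((integrableOn_gaussKernel hy _ _ T q j).const_mul _)
          (Eventually.of_forall fun u => mul_nonneg (by positivity) (gaussKernel_nonneg _ _)),
          integral_const_mul, ENNReal.ofReal_mul (by positivity)]
    _ ≤ ENNReal.ofReal (c * v) * (C * ENNReal.ofReal (((1 / 2) ^ q) ^ β)) := by
        gcongr
        exact smoothedOcc_le_of_chainSum hy hT hβ1 hm hn hj
    _ = ENNReal.ofReal (c * v * (C.toReal * ((1 / 2) ^ q) ^ β)) := by
        rw [ENNReal.ofReal_mul (by positivity : 0 ≤ c * v),
          ENNReal.ofReal_mul (by positivity : 0 ≤ C.toReal),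
          ENNReal.ofReal_toReal hCfin]
    _ ≤ ENNReal.ofReal (c * v * (C.toReal * ((2 / T) ^ β * (t - s) ^ β))) := by
        rw [← Real.mul_rpow (by positivity) (by linarith)]
        gcongr
    _ = _ := by
        rw [hvol, ← ENNReal.ofReal_mul]
        · congr 1; ring
        · have := sub_pos.mpr hst
          positivity

end Chaining

section ChainSumFinite

variable {Ω : Type*} [MeasurableSpace Ω] {d : ℕ} {P : Measure Ω} [IsProbabilityMeasure P]
  {Y : ℝ → Ω → Ed d} {T α θ p : ℝ}

lemma measurable_smoothedOcc (hY : Measurable (Function.uncurry Y)) (k : ℕ) (n : Fin d → ℤ)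
    (I : Set ℝ) : Measurable fun ω => smoothedOcc (fun s => Y s ω) k n I := by
  have h : Measurable fun q : Ω × ℝ =>
      gaussKernel ((1 / 2) ^ k) (Function.uncurry Y (q.2, q.1) - gridPt k n) :=
    (continuous_gaussKernel _).measurable.comp ((hY.comp (by fun_prop)).sub_const _)
  exact (h.stronglyMeasurable.integral_prod_right' (ν := volume.restrict I)).measurable

lemma measurable_chainTerm (hY : Measurable (Function.uncurry Y)) (T β : ℝ) (m k q : ℕ)
    (n : Fin d → ℤ) (j : ℕ) : Measurable fun ω => chainTerm (fun s => Y s ω) T β m k q n j := by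
  unfold chainTerm
  exact ((((measurable_smoothedOcc hY _ _ _).sub
    (measurable_smoothedOcc hY _ _ _)).enorm.const_mul _).pow_const _).mul_const _

lemma exists_lintegral_smoothedOcc_sub_le (hT : 0 < T) (hα : 0 < α) (hp : 0 < p) (hp1 : p ≤ 1)
    (hd : 0 < d) (hκ : α * d * (1 + p) < 1) (hY : Measurable (Function.uncurry Y))
    (hA1 : CondA1 P Y T α θ) (hY0 : ∀ ω, Y 0 ω = 0) {m : ℕ} (hm : 0 < m) (hme : Even m) :
    ∃ K : ℝ≥0∞, K ≠ ∞ ∧ ∀ (k : ℕ) (n : Fin d → ℤ) (q j : ℕ), j < 2 ^ q →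
      ∫⁻ ω, ‖smoothedOcc (fun s => Y s ω) (k + 1) n (dyadicIco T q j) -
        smoothedOcc (fun s => Y s ω) k (gridParent n) (dyadicIco T q j)‖ₑ ^ m ∂P ≤
      K * ENNReal.ofReal (((1 / 2) ^ (k + 1)) ^ (p / 2) *
        ((1 / 2) ^ q) ^ (1 - α * d * (1 + p))) ^ m := by
  obtain ⟨K, hK, hle⟩ := exists_lintegral_enorm_pow_le hT hα hp hp1 hd hκ hY hA1 hY0 hm hme
  set κ := α * d * (1 + p) with hκdef
  have h1κ : 0 < 1 - κ := by linarith
  refine ⟨K * ENNReal.ofReal ((4 + d) * (2 * T) ^ (1 - κ)) ^ m, by finiteness,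
    fun k n q j hj => ?_⟩
  set ε : ℝ := (1 / 2) ^ (k + 1) with hε
  have hε0 : 0 < ε := by positivity
  have h2ε : 2 * ε = (1 / 2) ^ k := by rw [hε, pow_succ]; ring
  have hYω : ∀ ω, Measurable fun s => Y s ω := fun ω => hY.of_uncurry_right
  have hint₁ : Integrable (gaussSymbol ε (gridPt (k + 1) n)) := integrable_gaussSymbol hε0 _
  have hint₂ : Integrable (gaussSymbol (2 * ε) (gridPt k (gridParent n))) :=
    integrable_gaussSymbol (by positivity) _
  have hbdd : ∀ (y : Ed d) (a : Ed d → ℂ), Integrable a →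
      Integrable fun u => a u * Complex.exp (Complex.I * Complex.ofReal ⟪u, y⟫) := by
    intro y a ha
    refine ha.mul_bdd (c := 1) ?_ (Eventually.of_forall fun u => ?_)
    · have : Continuous fun u : Ed d => Complex.exp (Complex.I * Complex.ofReal ⟪u, y⟫) := by
        fun_prop
      exact this.aestronglyMeasurable
    · rw [mul_comm, Complex.norm_exp_ofReal_mul_I]
  have h := hle ((4 + d) * ε ^ (p / 2))
    (fun y => gaussKernel ε (y - gridPt (k + 1) n) -
      gaussKernel (2 * ε) (y - gridPt k (gridParent n)))
    (fun u => gaussSymbol ε (gridPt (k + 1) n) u -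
      gaussSymbol (2 * ε) (gridPt k (gridParent n)) u)
    (by positivity) (hint₁.sub hint₂)
    (((continuous_gaussKernel _).comp (by fun_prop)).sub
      ((continuous_gaussKernel _).comp (by fun_prop))).measurable
    (fun y => by
      simp_rw [sub_mul]
      rw [integral_sub (hbdd y _ hint₁) (hbdd y _ hint₂), ← gaussKernel_eq_integral hε0,
        ← gaussKernel_eq_integral (by positivity), Complex.ofReal_sub])
    (fun u => norm_gaussSymbol_sub_le hε0 (by positivity) hp hp1 (norm_gridPt_sub_parent_le k n) u)
    (T * (j * (1 / 2) ^ q)) (min (T * ((j + 2) * (1 / 2) ^ q)) T) (by positivity)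
    (dyadicIco_start_lt hT hj) (min_le_right _ _)
  have hsub : ∀ ω, smoothedOcc (fun s => Y s ω) (k + 1) n (dyadicIco T q j) -
      smoothedOcc (fun s => Y s ω) k (gridParent n) (dyadicIco T q j) =
      ∫ s in dyadicIco T q j, (gaussKernel ε (Y s ω - gridPt (k + 1) n) -
        gaussKernel (2 * ε) (Y s ω - gridPt k (gridParent n))) := by
    intro ω
    rw [integral_sub (integrableOn_gaussKernel (hYω ω) _ _ _ _ _)
      (integrableOn_gaussKernel (hYω ω) _ _ _ _ _), smoothedOcc, smoothedOcc, ← h2ε]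
  simp_rw [hsub]
  refine h.trans ?_
  rw [mul_assoc, ← mul_pow]
  refine mul_le_mul' le_rfl (pow_le_pow_left' ?_ m)
  have hlen : ENNReal.ofReal (min (T * ((j + 2) * (1 / 2) ^ q)) T - T * (j * (1 / 2) ^ q)) ^
      (1 - κ) ≤ ENNReal.ofReal ((2 * T) ^ (1 - κ) * ((1 / 2) ^ q) ^ (1 - κ)) := by
    rw [← Real.mul_rpow (by positivity) (by positivity),
      ← ENNReal.ofReal_rpow_of_nonneg (by positivity) h1κ.le]
    gcongr
    exact dyadicIco_length_le T q j
  refine (mul_le_mul' le_rfl hlen).trans (le_of_eq ?_)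
  rw [← ENNReal.ofReal_mul (by positivity), ← ENNReal.ofReal_mul (by positivity)]
  congr 1
  ring

/-- The chaining sums are almost surely finite. -/
lemma ae_chainSum_ne_top (hT : 0 < T) (hα : 0 < α) (hp : 0 < p) (hp1 : p ≤ 1)
    (hd : 0 < d) (hκ : α * d * (1 + p) < 1) (hY : Measurable (Function.uncurry Y))
    (hA1 : CondA1 P Y T α θ) (hY0 : ∀ ω, Y 0 ω = 0) {m : ℕ} (hm : 0 < m) (hme : Even m)
    {β : ℝ} (hmp : (d : ℝ) + 2 ≤ p / 2 * m) (hmβ : 2 ≤ (1 - α * d * (1 + p) - β) * m) (R : ℕ) :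
    ∀ᵐ ω ∂P, chainSum (fun s => Y s ω) T β m R ≠ ∞ := by
  obtain ⟨K, hK, hle⟩ :=
    exists_lintegral_smoothedOcc_sub_le hT hα hp hp1 hd hκ hY hA1 hY0 hm hme
  set κ := α * d * (1 + p) with hκdef
  have h2i : (2 : ℝ≥0∞) * 2⁻¹ = 1 := ENNReal.mul_inv_cancel (by simp) (by simp)
  have hhalf : ENNReal.ofReal (1 / 2) = 2⁻¹ := by
    rw [one_div, ENNReal.ofReal_inv_of_pos two_pos, ENNReal.ofReal_ofNat]
  have hpow : ∀ (x : ℝ) (i N : ℕ), 0 ≤ x → (N : ℝ) ≤ x * m →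
      ENNReal.ofReal (((1 / 2) ^ i) ^ x) ^ m ≤ (2⁻¹ ^ i) ^ N := by
    intro x i N hx hN
    rw [← hhalf, ← ENNReal.ofReal_pow (by positivity), ← ENNReal.ofReal_pow (by positivity),
      ← ENNReal.ofReal_pow (by positivity)]
    refine ENNReal.ofReal_le_ofReal ?_
    rw [← Real.rpow_natCast (((1 / 2 : ℝ) ^ i) ^ x), ← Real.rpow_mul (by positivity),
      ← Real.rpow_natCast _ N]
    exact Real.rpow_le_rpow_of_exponent_ge (by positivity)
      (pow_le_one₀ (by norm_num) (by norm_num)) hN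
  have hδ : 0 < 1 - κ - β := by
    by_contra! hneg
    have := mul_nonpos_of_nonpos_of_nonneg hneg (Nat.cast_nonneg (α := ℝ) m)
    linarith
  have hterm : ∀ (k q : ℕ) (n : Fin d → ℤ) (j : ℕ), j < 2 ^ q →
      ∫⁻ ω, chainTerm (fun s => Y s ω) T β m k q n j ∂P ≤
        K * (2⁻¹ ^ (k + 1)) ^ (d + 2) * (2⁻¹ ^ q) ^ 2 * 2 ^ k := by
    intro k q n j hj
    simp only [chainTerm]
    simp_rw [mul_pow]
    rw [lintegral_mul_const' _ _ (by finiteness), lintegral_const_mul' _ _ (by finiteness)]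
    refine mul_le_mul' ((mul_le_mul' le_rfl (hle k n q j hj)).trans ?_) le_rfl
    have hq0 : (0 : ℝ) < (1 / 2) ^ q := by positivity
    have hsplit : ((1 / 2 : ℝ) ^ q) ^ (-β) * ((1 / 2) ^ q) ^ (1 - κ) =
        ((1 / 2) ^ q) ^ (1 - κ - β) := by
      rw [← Real.rpow_add hq0]; congr 1; ring
    calc _ = K * ENNReal.ofReal (((1 / 2) ^ (k + 1)) ^ (p / 2)) ^ m *
          ENNReal.ofReal (((1 / 2) ^ q) ^ (1 - κ - β)) ^ m := by
          rw [← hsplit, ENNReal.ofReal_mul (by positivity), ENNReal.ofReal_mul (by positivity)]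
          ring
      _ ≤ _ := mul_le_mul' (mul_le_mul' le_rfl
          (hpow _ _ _ (by positivity) (by push_cast; exact hmp)))
          (hpow _ _ _ hδ.le (by push_cast; exact hmβ))
  have hmeas : ∀ k q n j, Measurable fun ω => chainTerm (fun s => Y s ω) T β m k q n j :=
    fun k q n j => measurable_chainTerm hY T β m k q n j
  have hmeasS : ∀ k q, Measurable fun ω => ∑ n ∈ gridBox d R (k + 1),
      ∑ j ∈ Finset.range (2 ^ q), chainTerm (fun s => Y s ω) T β m k q n j := fun k q =>
    Finset.measurable_sum _ fun n _ => Finset.measurable_sum _ fun j _ => hmeas k q n j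
  have hinner : ∀ k q : ℕ, ∫⁻ ω, ∑ n ∈ gridBox d R (k + 1),
      ∑ j ∈ Finset.range (2 ^ q), chainTerm (fun s => Y s ω) T β m k q n j ∂P ≤
      K * (2 * R + 1) ^ d * 2⁻¹ ^ k * 2⁻¹ ^ q := by
    intro k q
    rw [lintegral_finsetSum _ fun n _ => Finset.measurable_sum _ fun j _ => hmeas k q n j]
    simp_rw [lintegral_finsetSum _ fun j _ => hmeas k q _ j]
    calc _ ≤ ∑ _n ∈ gridBox d R (k + 1), ∑ _j ∈ Finset.range (2 ^ q),
          K * (2⁻¹ ^ (k + 1)) ^ (d + 2) * (2⁻¹ ^ q) ^ 2 * 2 ^ k :=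
          Finset.sum_le_sum fun n _ => Finset.sum_le_sum fun j hj =>
            hterm k q n j (Finset.mem_range.mp hj)
      _ = ((gridBox d R (k + 1)).card : ℝ≥0∞) * ((2 : ℝ≥0∞) ^ q *
          (K * (2⁻¹ ^ (k + 1)) ^ (d + 2) * (2⁻¹ ^ q) ^ 2 * 2 ^ k)) := by
          simp [Finset.sum_const]
      _ ≤ ((2 * R + 1) * 2 ^ (k + 1)) ^ d * ((2 : ℝ≥0∞) ^ q *
          (K * (2⁻¹ ^ (k + 1)) ^ (d + 2) * (2⁻¹ ^ q) ^ 2 * 2 ^ k)) := by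
          gcongr
          exact_mod_cast card_gridBox_le d R (k + 1)
      _ = K * (2 * R + 1) ^ d * ((2 * 2⁻¹) ^ (k + 1)) ^ d * (2 * 2⁻¹) ^ k * (2 * 2⁻¹) ^ q *
          (2⁻¹ ^ k * 2⁻¹ ^ 2) * 2⁻¹ ^ q := by
          simp only [mul_pow]
          ring
      _ ≤ K * (2 * R + 1) ^ d * 1 * 1 * 1 * (2⁻¹ ^ k * 1) * 2⁻¹ ^ q := by
          rw [h2i]
          simp only [one_pow]
          gcongr
          exact pow_le_one₀ (by simp) (by simp)
      _ = _ := by ring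
  have htot : ∫⁻ ω, chainSum (fun s => Y s ω) T β m R ∂P ≠ ∞ := by
    simp only [chainSum]
    rw [lintegral_tsum fun k => (Measurable.tsum fun q => hmeasS k q).aemeasurable]
    simp_rw [lintegral_tsum fun q => (hmeasS _ q).aemeasurable]
    refine ne_top_of_le_ne_top ?_
      (ENNReal.tsum_le_tsum fun k => ENNReal.tsum_le_tsum fun q => hinner k q)
    simp_rw [ENNReal.tsum_mul_left, ENNReal.tsum_mul_right, ENNReal.tsum_mul_left,
      ENNReal.tsum_geometric]
    have : (1 : ℝ≥0∞) - 2⁻¹ ≠ 0 := by simp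
    finiteness
  have hmeasC : Measurable fun ω => chainSum (fun s => Y s ω) T β m R := by
    unfold chainSum
    exact Measurable.tsum fun k => Measurable.tsum fun q => hmeasS k q
  filter_upwards [ae_lt_top hmeasC htot] with ω hω using hω.ne

end ChainSumFinite

section BallDensity

variable {d : ℕ}

/-- The upper density of a measure along dyadic balls. -/
def ballDensity (ρ : Measure (Ed d)) (x : Ed d) : ℝ≥0∞ :=
  limsup (fun k : ℕ => ρ (Metric.closedBall x ((1 / 2) ^ k)) /
    volume (Metric.closedBall x ((1 / 2) ^ k))) atTop

lemma tendsto_half_pow_nhdsGT_zero : Tendsto (fun k : ℕ => (1 / 2 : ℝ) ^ k) atTop (𝓝[>] 0) :=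
  tendsto_nhdsWithin_iff.mpr ⟨tendsto_pow_atTop_nhds_zero_of_lt_one (by norm_num) (by norm_num),
    Eventually.of_forall fun _ => mem_Ioi.mpr (by positivity)⟩

lemma volume_half_pow_closedBall_ne_zero (x : Ed d) (k : ℕ) :
    volume (Metric.closedBall x ((1 / 2) ^ k)) ≠ 0 :=
  (Metric.measure_closedBall_pos volume x (by positivity)).ne'

lemma absolutelyContinuous_of_closedBall_le {ρ : Measure (Ed d)} [IsFiniteMeasure ρ] {C : ℝ≥0∞}
    (hC : C ≠ ∞) (h : ∀ (k : ℕ) (x : Ed d), ρ (Metric.closedBall x ((1 / 2) ^ k)) ≤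
      C * volume (Metric.closedBall x ((1 / 2) ^ k))) : ρ ≪ volume := by
  lift C to ℝ≥0 using hC
  intro A hA
  have := (Besicovitch.vitaliFamily ρ).measure_le_of_frequently_le (C • volume)
    Measure.AbsolutelyContinuous.rfl A fun x _ =>
      ((Besicovitch.tendsto_filterAt ρ x).comp tendsto_half_pow_nhdsGT_zero).frequently
        (Frequently.of_forall fun k => by simpa using h k x)
  simpa [hA] using this

lemma ofReal_setIntegral_toReal_ballDensity {ρ : Measure (Ed d)} [IsFiniteMeasure ρ]
    (h : ρ ≪ volume) (A : Set (Ed d)) :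
    ENNReal.ofReal (∫ x in A, (ballDensity ρ x).toReal) = ρ A := by
  have hae : (fun x => (ballDensity ρ x).toReal) =ᵐ[volume]
      fun x => (ρ.rnDeriv volume x).toReal := by
    filter_upwards [Besicovitch.ae_tendsto_rnDeriv ρ volume] with x hx
    exact congrArg ENNReal.toReal (hx.comp tendsto_half_pow_nhdsGT_zero).limsup_eq
  rw [integral_congr_ae (ae_restrict_of_ae hae), Measure.setIntegral_toReal_rnDeriv h,
    ofReal_measureReal]

lemma ballDensity_le_add {ρ ρ' : Measure (Ed d)} {C : ℝ≥0∞} {x : Ed d}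
    (h : ∀ k : ℕ, ρ (Metric.closedBall x ((1 / 2) ^ k)) ≤
      ρ' (Metric.closedBall x ((1 / 2) ^ k)) + C * volume (Metric.closedBall x ((1 / 2) ^ k))) :
    ballDensity ρ x ≤ ballDensity ρ' x + C := by
  calc ballDensity ρ x
      ≤ limsup (fun k : ℕ => ρ' (Metric.closedBall x ((1 / 2) ^ k)) /
          volume (Metric.closedBall x ((1 / 2) ^ k)) + C) atTop := by
        refine limsup_le_limsup (Eventually.of_forall fun k => ?_)
        refine (ENNReal.div_le_div_right (h k) _).trans (le_of_eq ?_)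
        rw [ENNReal.add_div, ENNReal.mul_div_cancel_right
          (volume_half_pow_closedBall_ne_zero x k) measure_closedBall_lt_top.ne]
    _ = _ := limsup_add_const _ _ _ (by isBoundedDefault) (by isBoundedDefault)

/-- The density at `x` of the occupation measure of the path `y` up to time `t`. -/
def occDensity (y : ℝ → Ed d) (x : Ed d) (t : ℝ) : ℝ :=
  (ballDensity ((volume.restrict (Icc 0 t)).map y) x).toReal

variable {y : ℝ → Ed d} {T β K : ℝ}

lemma map_restrict_Icc_closedBall (hy : Measurable y) (t : ℝ) (x : Ed d) (r : ℝ) :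
    (volume.restrict (Icc 0 t)).map y (Metric.closedBall x r) =
      volume (Icc 0 t ∩ y ⁻¹' Metric.closedBall x r) := by
  rw [Measure.map_apply hy Metric.isClosed_closedBall.measurableSet,
    Measure.restrict_apply (hy Metric.isClosed_closedBall.measurableSet), inter_comm]

lemma volume_Icc_inter_eq_ofReal_integral_occDensity (hy : Measurable y)
    (hK : ∀ (k : ℕ) (x : Ed d) (s t : ℝ), 0 ≤ s → s ≤ t → t ≤ T →
      volume (Icc s t ∩ y ⁻¹' Metric.closedBall x ((1 / 2) ^ k)) ≤
        ENNReal.ofReal (K * (t - s) ^ β) * volume (Metric.closedBall x ((1 / 2) ^ k)))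
    {t : ℝ} (ht : t ∈ Icc 0 T) {A : Set (Ed d)} (hA : MeasurableSet A) :
    volume (Icc 0 t ∩ y ⁻¹' A) = ENNReal.ofReal (∫ x in A, occDensity y x t) := by
  unfold occDensity
  rw [ofReal_setIntegral_toReal_ballDensity, Measure.map_apply hy hA,
    Measure.restrict_apply (hy hA), inter_comm]
  refine absolutelyContinuous_of_closedBall_le (C := ENNReal.ofReal (K * (t - 0) ^ β))
    ENNReal.ofReal_ne_top fun k x => ?_
  rw [map_restrict_Icc_closedBall hy]
  exact hK k x 0 t le_rfl ht.1 ht.2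

lemma abs_occDensity_sub_le (hy : Measurable y) (hK0 : 0 ≤ K)
    (hK : ∀ (k : ℕ) (x : Ed d) (s t : ℝ), 0 ≤ s → s ≤ t → t ≤ T →
      volume (Icc s t ∩ y ⁻¹' Metric.closedBall x ((1 / 2) ^ k)) ≤
        ENNReal.ofReal (K * (t - s) ^ β) * volume (Metric.closedBall x ((1 / 2) ^ k)))
    (x : Ed d) {s t : ℝ} (hs : s ∈ Icc 0 T) (ht : t ∈ Icc 0 T) :
    |occDensity y x t - occDensity y x s| ≤ K * |t - s| ^ β := by
  wlog hst : s ≤ t generalizing s t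
  · rw [abs_sub_comm, abs_sub_comm t]
    exact this ht hs (le_of_not_ge hst)
  have hinc : ∀ r u, 0 ≤ r → r ≤ u → u ≤ T →
      ballDensity ((volume.restrict (Icc 0 u)).map y) x ≤
        ballDensity ((volume.restrict (Icc 0 r)).map y) x + ENNReal.ofReal (K * (u - r) ^ β) := by
    intro r u hr hru hu
    refine ballDensity_le_add fun k => ?_
    rw [map_restrict_Icc_closedBall hy, map_restrict_Icc_closedBall hy,
      ← Icc_union_Icc_eq_Icc hr hru, union_inter_distrib_right]
    exact (measure_union_le _ _).trans (add_le_add le_rfl (hK k x r u hr hru hu))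
  have hmono : ballDensity ((volume.restrict (Icc 0 s)).map y) x ≤
      ballDensity ((volume.restrict (Icc 0 t)).map y) x := by
    have := ballDensity_le_add (ρ := (volume.restrict (Icc 0 s)).map y)
      (ρ' := (volume.restrict (Icc 0 t)).map y) (C := 0) (x := x) fun k => by
        rw [zero_mul, add_zero, map_restrict_Icc_closedBall hy, map_restrict_Icc_closedBall hy]
        gcongr
    simpa using this
  have hfin : ∀ u ∈ Icc 0 T, ballDensity ((volume.restrict (Icc 0 u)).map y) x ≠ ∞ := by
    intro u hu
    refine ne_top_of_le_ne_top ?_ (hinc 0 u le_rfl hu.1 hu.2)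
    simp [ballDensity]
  have hle := ENNReal.toReal_mono (by simpa using hfin s hs) (hinc s t hs.1 hst ht.2)
  rw [ENNReal.toReal_add (hfin s hs) ENNReal.ofReal_ne_top, ENNReal.toReal_ofReal
    (mul_nonneg hK0 (Real.rpow_nonneg (sub_nonneg.mpr hst) _))] at hle
  rw [occDensity, occDensity, abs_of_nonneg (sub_nonneg.mpr (ENNReal.toReal_mono (hfin t ht) hmono)),
    abs_of_nonneg (sub_nonneg.mpr hst)]
  linarith

end BallDensity

/-- A path that is continuous on `[0, T]` becomes continuous when stopped at the end points. -/
lemma continuous_comp_projIcc {E : Type*} [TopologicalSpace E] {T : ℝ} {f : ℝ → E} (hT : 0 ≤ T)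
    (hf : ContinuousOn f (Icc 0 T)) : Continuous fun t => f (projIcc 0 T hT t) :=
  hf.comp_continuous (continuous_subtype_val.comp continuous_projIcc) fun t => (projIcc 0 T hT t).2

section SmallBalls

variable {Ω : Type*} [MeasurableSpace Ω] {d : ℕ} {P : Measure Ω} {T α θ : ℝ}

/-- Almost surely, the occupation of small balls is Hölder continuous in time, uniformly in
the centre and the radius of the ball. -/
lemma ae_exists_volume_Icc_inter_preimage_le [IsProbabilityMeasure P] {Y : ℝ → Ω → Ed d}
    (hT : 0 < T) (hα : 0 < α) (hd : 0 < d) (hY : ∀ t, Measurable (Y t))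
    (hYc : ∀ ω, Continuous fun t => Y t ω) (hA1 : CondA1 P Y T α θ) (hY0 : ∀ ω, Y 0 ω = 0)
    {β : ℝ} (hβ : 0 < β) (hβ1 : β < 1 - d * α) :
    ∀ᵐ ω ∂P, ∃ K : ℝ, 0 ≤ K ∧ ∀ (k : ℕ) (x : Ed d) (s t : ℝ), 0 ≤ s → s ≤ t → t ≤ T →
      volume (Icc s t ∩ (fun u => Y u ω) ⁻¹' Metric.closedBall x ((1 / 2) ^ k)) ≤
        ENNReal.ofReal (K * (t - s) ^ β) * volume (Metric.closedBall x ((1 / 2) ^ k)) := by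
  have hd0 : (0 : ℝ) < d := by exact_mod_cast hd
  have hdα : 0 < d * α := by positivity
  set g := 1 - d * α - β with hg
  have hg0 : 0 < g := by linarith
  set p := min 1 (g / (2 * (d * α))) with hp
  have hp0 : 0 < p := by positivity
  have hpg : d * α * p ≤ g / 2 := by
    calc d * α * p ≤ d * α * (g / (2 * (d * α))) := by gcongr; exact min_le_right _ _
      _ = g / 2 := by field_simp
  have hδ : g / 2 ≤ 1 - α * d * (1 + p) - β := by
    rw [hg] at hpg ⊢
    linarith
  obtain ⟨N, hN⟩ := exists_nat_ge (max ((d + 2) / p) (2 / g))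
  have hN₁ : (d : ℝ) + 2 ≤ N * p := (div_le_iff₀ hp0).mp ((le_max_left _ _).trans hN)
  have hN₂ : 2 ≤ N * g := (div_le_iff₀ hg0).mp ((le_max_right _ _).trans hN)
  have hN0 : 0 < N := by
    rw [Nat.pos_iff_ne_zero]
    rintro rfl
    simp at hN₂
    linarith
  have hYm : Measurable (Function.uncurry Y) :=
    measurable_uncurry_of_continuous_of_measurable hYc hY
  have hfin := ae_all_iff.mpr fun R : ℕ => ae_chainSum_ne_top (β := β) hT hα hp0 (min_le_left _ _) hd
    (by linarith) hYm hA1 hY0 (m := 2 * N) (by omega) (even_two_mul N)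
    (by push_cast; linarith)
    (by
      push_cast
      calc (2 : ℝ) ≤ g / 2 * (2 * N) := by linarith
        _ ≤ _ := by gcongr) R
  filter_upwards [hfin] with ω hω
  obtain ⟨M, hM⟩ := isCompact_Icc.exists_bound_of_continuousOn (s := Icc 0 T) (hYc ω).continuousOn
  obtain ⟨R, hR⟩ := exists_nat_ge (M + 1)
  obtain ⟨K, hK0, hK⟩ := exists_volume_Icc_inter_preimage_le hYm.of_uncurry_right hT hβ
    (by linarith) (by omega) (hω R)
  refine ⟨K, hK0, fun k x s t hs hst ht => ?_⟩
  by_cases hx : ∀ l, |x l| ≤ R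
  · exact hK k x hx s t hs hst ht
  push Not at hx
  obtain ⟨l, hl⟩ := hx
  have hempty : Icc s t ∩ (fun u => Y u ω) ⁻¹' Metric.closedBall x ((1 / 2) ^ k) = ∅ := by
    refine eq_empty_of_forall_notMem fun u hu => ?_
    have h1 := hM u ⟨hs.trans hu.1.1, hu.1.2.trans ht⟩
    have h2 : ‖Y u ω - x‖ ≤ (1 / 2) ^ k := by simpa [dist_eq_norm] using hu.2
    have h3 : (1 / 2 : ℝ) ^ k ≤ 1 := pow_le_one₀ (by norm_num) (by norm_num)
    have h4 : |x l| ≤ ‖x‖ := PiLp.norm_apply_le x l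
    have h5 : ‖x‖ ≤ ‖Y u ω‖ + ‖Y u ω - x‖ := by
      simpa using norm_sub_le (Y u ω) (Y u ω - x)
    linarith
  rw [hempty, measure_empty]
  exact zero_le

/-- A version of the centred path with all trajectories continuous on the real line. -/
def centredPath (P : Measure Ω) (X : ℝ → Ω → Ed d) (hT : 0 ≤ T) (t : ℝ) (ω : Ω) : Ed d :=
  (toMeasurable P {ω | ¬ ContinuousOn (fun u => X u ω) (Icc 0 T)})ᶜ.indicator
    (fun ω => X (projIcc 0 T hT t) ω - X 0 ω) ω

variable {X : ℝ → Ω → Ed d}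

lemma measurable_centredPath (hX : ∀ t, Measurable (X t)) (hT : 0 ≤ T) (t : ℝ) :
    Measurable (centredPath P X hT t) :=
  ((hX _).sub (hX _)).indicator (measurableSet_toMeasurable _ _).compl

lemma continuous_centredPath (hT : 0 ≤ T) (ω : Ω) :
    Continuous fun t => centredPath P X hT t ω := by
  by_cases hω : ω ∈ (toMeasurable P {ω | ¬ ContinuousOn (fun u => X u ω) (Icc 0 T)})ᶜ
  · simp only [centredPath, indicator_of_mem hω]
    refine (continuous_comp_projIcc (f := fun u => X u ω) hT ?_).sub continuous_const
    by_contra h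
    exact hω (subset_toMeasurable _ _ h)
  · simp only [centredPath, indicator_of_notMem hω]
    exact continuous_const

lemma centredPath_zero (hT : 0 ≤ T) (ω : Ω) : centredPath P X hT 0 ω = 0 := by
  simp [centredPath]

lemma ae_centredPath_eq (hT : 0 ≤ T)
    (hX : ∀ᵐ ω ∂P, ContinuousOn (fun u => X u ω) (Icc 0 T)) :
    ∀ᵐ ω ∂P, ∀ t, centredPath P X hT t ω = X (projIcc 0 T hT t) ω - X 0 ω := by
  have h : ∀ᵐ ω ∂P, ω ∈ (toMeasurable P {ω | ¬ ContinuousOn (fun u => X u ω) (Icc 0 T)})ᶜ := by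
    rw [ae_iff]
    simpa only [mem_compl_iff, not_not, ofPred_mem_eq, measure_toMeasurable] using ae_iff.mp hX
  filter_upwards [h] with ω hω t
  exact indicator_of_mem hω _

lemma CondA1.centredPath (hT : 0 ≤ T)
    (hX : ∀ᵐ ω ∂P, ContinuousOn (fun u => X u ω) (Icc 0 T)) (hA1 : CondA1 P X T α θ) :
    CondA1 P (centredPath P X hT) T α θ := by
  obtain ⟨C, hC, h⟩ := hA1
  refine ⟨C, hC, fun m hm ξ hξ t ht ht0 htT k hk => ?_⟩
  refine le_of_eq_of_le (congrArg norm (integral_congr_ae ?_)) (h m hm ξ hξ t ht ht0 htT k hk)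
  filter_upwards [ae_centredPath_eq hT hX] with ω hω
  have hproj : ∀ i, (projIcc 0 T hT (t i) : ℝ) = t i := fun i => by
    rw [projIcc_of_mem hT ⟨ht0.symm.trans_le (ht.monotone (Fin.zero_le i)),
      (ht.monotone (Fin.le_last i)).trans htT.le⟩]
  simp only [hω, hproj, sub_sub_sub_cancel_right]

end SmallBalls

/-- under (A1) and (A2), there exist a version `L̃` of the local time and,
for every `β ∈ (0, 1 - dα)`, a finite random variable `η` such that almost surely
`|L̃(x,t) - L̃(x,s)| ≤ η |t-s|^β` for all `x ∈ ℝ^d` and `s, t ∈ [0,T]`. -/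
theorem localTime_time_holder
    {Ω : Type*} [MeasurableSpace Ω] (P : Measure Ω) [IsProbabilityMeasure P]
    {d : ℕ} (hd : 0 < d) (T : ℝ) (hT : 0 < T)
    (X : ℝ → Ω → Ed d) (hmeas : ∀ t : ℝ, Measurable (X t))
    (hpath : ∀ᵐ ω ∂P, ContinuousOn (fun u => X u ω) (Icc 0 T))
    (α θ ι : ℝ) (hα : 0 < α) (hαd : α < 1 / d) (hθ : 0 ≤ θ) (hι : ι ∈ Icc (0 : ℝ) 1)
    (hA1 : CondA1 P X T α θ) (hA2 : CondA2 P X T α ι) :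
    ∃ L : Ed d → ℝ → Ω → ℝ,
      (∀ᵐ ω ∂P, ∀ t ∈ Icc (0 : ℝ) T, ∀ A : Set (Ed d), MeasurableSet A →
        volume (Icc 0 t ∩ {u | X u ω ∈ A}) = ENNReal.ofReal (∫ x in A, L x t ω)) ∧
      ∀ β : ℝ, 0 < β → β < 1 - d * α →
        ∃ η : Ω → ℝ, ∀ᵐ ω ∂P, ∀ x : Ed d, ∀ s ∈ Icc (0 : ℝ) T, ∀ t ∈ Icc (0 : ℝ) T,
          |L x t ω - L x s ω| ≤ η ω * |t - s| ^ β := by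
  have hbound : ∀ β : ℝ, 0 < β → β < 1 - d * α → ∀ᵐ ω ∂P,
      Measurable (fun u => X (projIcc 0 T hT.le u) ω) ∧
      ∃ K : ℝ, 0 ≤ K ∧ ∀ (k : ℕ) (x : Ed d) (s t : ℝ), 0 ≤ s → s ≤ t → t ≤ T →
        volume (Icc s t ∩ (fun u => X (projIcc 0 T hT.le u) ω) ⁻¹'
            Metric.closedBall x ((1 / 2) ^ k)) ≤
          ENNReal.ofReal (K * (t - s) ^ β) * volume (Metric.closedBall x ((1 / 2) ^ k)) := by
    intro β hβ hβ1
    filter_upwards [hpath, ae_centredPath_eq hT.le hpath,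
      ae_exists_volume_Icc_inter_preimage_le hT hα hd (measurable_centredPath hmeas hT.le)
        (continuous_centredPath hT.le) (hA1.centredPath hT.le hpath) (centredPath_zero hT.le)
        hβ hβ1] with ω hω heq ⟨K, hK0, hK⟩
    refine ⟨(continuous_comp_projIcc hT.le hω).measurable, K, hK0, fun k x s t hs hst ht => ?_⟩
    convert hK k (x - X 0 ω) s t hs hst ht using 2
    · ext u
      simp [heq, dist_eq_norm]
    · rw [Measure.addHaar_closedBall_center, Measure.addHaar_closedBall_center _ (x - X 0 ω)]
  refine ⟨fun x t ω => occDensity (fun u => X (projIcc 0 T hT.le u) ω) x t, ?_, ?_⟩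
  · have hdα : 0 < 1 - d * α := by
      have hd0 : (0 : ℝ) < d := by exact_mod_cast hd
      have := (lt_div_iff₀ hd0).mp hαd
      linarith
    filter_upwards [hbound ((1 - d * α) / 2) (by linarith) (by linarith)]
      with ω ⟨hy, K, _, hK⟩ t ht A hA
    rw [← volume_Icc_inter_eq_ofReal_integral_occDensity hy hK ht hA]
    congr 1
    ext u
    simp only [mem_inter_iff, mem_ofPred_eq, mem_preimage]
    refine and_congr_right fun hu => ?_
    rw [projIcc_of_mem hT.le ⟨hu.1, hu.2.trans ht.2⟩]
  · intro β hβ hβ1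
    have hη : ∀ᵐ ω ∂P, ∃ K : ℝ, ∀ x : Ed d, ∀ s ∈ Icc (0 : ℝ) T, ∀ t ∈ Icc (0 : ℝ) T,
        |occDensity (fun u => X (projIcc 0 T hT.le u) ω) x t -
          occDensity (fun u => X (projIcc 0 T hT.le u) ω) x s| ≤ K * |t - s| ^ β := by
      filter_upwards [hbound β hβ hβ1] with ω ⟨hy, K, hK0, hK⟩
      exact ⟨K, fun x s hs t ht => abs_occDensity_sub_le hy hK0 hK x hs ht⟩
    exact hη.choice
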